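/- arXiv:1410.4585 — 4 statements merged into one kernel-verified Lean document; each statement's English description precedes it below -/
import Mathlib

section
/- Let H be a bipartite graph on h vertices with hcf(H) = 1, σ(H) = u, w = h − σ(H), ζ = ζ(H) and β = β(H). Set c_1(H) = ζh² + β(w−u)² + (h/2 + 1)(w−u) + w. Then there exist α > 0 and an integer m_0 such that for every m ≥ m_0: if G[X,Y] is a balanced bipartite graph on 2n = mh vertices with δ(G) ≥ (u/h)n + c_1(H), and there exist subsets A ⊆ X, B ⊆ Y with |A| = |B| = ⌊wn/h⌋ and d(A,B) ≤ α, then G contains an H-factor. -/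
open Finset

attribute [local instance] Classical.propDecidable

namespace BipTiling

variable {α β V : Type*}

/-- A proper 2-coloring of the graph `H`. -/
def Proper2Coloring (H : SimpleGraph α) (c : α → Bool) : Prop :=
  ∀ ⦃a b : α⦄, H.Adj a b → c a ≠ c b

/-- `H` is bipartite, i.e. it admits a proper 2-coloring. -/
def IsBip (H : SimpleGraph α) : Prop :=
  ∃ c : α → Bool, Proper2Coloring H c

/-- The size of the color class of color `i` under the 2-coloring `c`. -/
noncomputable def colorCard [Fintype α] (c : α → Bool) (i : Bool) : ℕ :=
  (Finset.univ.filter fun v => c v = i).card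

/-- `σ(H)`: the smallest size of a color class over all proper 2-colorings of `H`. -/
noncomputable def sigmaBip [Fintype α] (H : SimpleGraph α) : ℕ :=
  sInf {k | ∃ c : α → Bool, Proper2Coloring H c ∧
    k = min (colorCard c true) (colorCard c false)}

/-- The finset of connected components of `H`. -/
noncomputable def comps [Fintype α] (H : SimpleGraph α) : Finset H.ConnectedComponent :=
  Finset.univ.image H.connectedComponentMk

/-- `c_i`: the number of vertices of the connected component `K`. -/
noncomputable def compCard [Fintype α] (H : SimpleGraph α) (K : H.ConnectedComponent) : ℕ :=
  (Finset.univ.filter fun v => H.connectedComponentMk v = K).card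

/-- `d_i = |W_i| - |U_i|`: the (absolute) difference of the sizes of the two color classes
of the component `K`, computed with respect to a proper 2-coloring `c` of `H`.
(For a proper 2-coloring this is independent of the choice of `c`, since the 2-coloring of a
connected bipartite graph is unique up to swapping the colors.) -/
noncomputable def compDiff [Fintype α] (H : SimpleGraph α) (c : α → Bool)
    (K : H.ConnectedComponent) : ℕ :=
  (((Finset.univ.filter fun v => H.connectedComponentMk v = K ∧ c v = true).card : ℤ) -
    ((Finset.univ.filter fun v => H.connectedComponentMk v = K ∧ c v = false).card : ℤ)).natAbs

/-- `hcf_c(H) = gcd(c_1, …, c_k)`. -/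
noncomputable def hcfC [Fintype α] (H : SimpleGraph α) : ℕ :=
  (comps H).gcd (compCard H)

/-- `hcf_{χ,c}(H) = gcd(d_1, …, d_k)`, with respect to a proper 2-coloring `c`. -/
noncomputable def hcfChiC [Fintype α] (H : SimpleGraph α) (c : α → Bool) : ℕ :=
  (comps H).gcd (compDiff H c)

/-- `x_2 - x_1` for the 2-coloring `c`, where `x_1 ≤ x_2` are the sizes of its color classes. -/
noncomputable def colorDiff [Fintype α] (c : α → Bool) : ℕ :=
  ((colorCard c true : ℤ) - (colorCard c false : ℤ)).natAbs

/-- `hcf_χ(H)`: the gcd of the set `D(H)` of all differences `x_2 - x_1` of color class sizes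
over all proper 2-colorings of `H` (`0` represents `∞`, i.e. `D(H) = {0}`). -/
noncomputable def hcfChi [Fintype α] (H : SimpleGraph α) : ℕ :=
  (Finset.univ.filter fun c : α → Bool => Proper2Coloring H c).gcd colorDiff

/-- `hcf(H) = 1` for a bipartite graph `H`: `hcf_c(H) = 1` and `hcf_χ(H) ≤ 2`
(in particular `hcf_χ(H)` is finite, i.e. nonzero in our encoding). -/
def HcfOne [Fintype α] (H : SimpleGraph α) : Prop :=
  hcfC H = 1 ∧ 0 < hcfChi H ∧ hcfChi H ≤ 2

/-- `f` is a copy of `H` inside `G` (an injective graph homomorphism). -/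
def IsCopy (H : SimpleGraph α) (G : SimpleGraph β) (f : α → β) : Prop :=
  Function.Injective f ∧ ∀ ⦃a b : α⦄, H.Adj a b → G.Adj (f a) (f b)

/-- `s` is an `H`-tiling of `G`: a finite collection of pairwise vertex-disjoint copies of `H`. -/
def IsHTiling (H : SimpleGraph α) (G : SimpleGraph β) (s : Finset (α → β)) : Prop :=
  (∀ f ∈ s, IsCopy H G f) ∧
    ∀ f ∈ s, ∀ g ∈ s, f ≠ g → ∀ a b : α, f a ≠ g b

/-- The set of vertices covered by the tiling `s`. -/
noncomputable def coveredSet [Fintype α] [Fintype β] (s : Finset (α → β)) : Finset β :=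
  s.biUnion fun f => Finset.univ.image f

/-- `G` has a perfect `H`-tiling (`H`-factor). -/
def HasHFactor [Fintype α] [Fintype β] (H : SimpleGraph α) (G : SimpleGraph β) : Prop :=
  ∃ s : Finset (α → β), IsHTiling H G s ∧ coveredSet s = Finset.univ

/-- `G` has an `H`-tiling covering all but at most `t` vertices. -/
def HasHTilingMissingAtMost [Fintype α] [Fintype β] (H : SimpleGraph α) (G : SimpleGraph β)
    (t : ℕ) : Prop :=
  ∃ s : Finset (α → β), IsHTiling H G s ∧ (Finset.univ \ coveredSet s).card ≤ t

/-- `G` is a bipartite graph with partition sets `X` and `Y`, written `G[X,Y]`. -/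
structure BipartiteWith [Fintype V] (G : SimpleGraph V) (X Y : Finset V) : Prop where
  disj : Disjoint X Y
  cover : X ∪ Y = Finset.univ
  cross : ∀ ⦃a b : V⦄, G.Adj a b → (a ∈ X ∧ b ∈ Y) ∨ (a ∈ Y ∧ b ∈ X)

/-- `e(A,B)`: the number of edges of `G` between `A` and `B`. -/
noncomputable def eAB (G : SimpleGraph V) (A B : Finset V) : ℕ :=
  ((A ×ˢ B).filter fun p => G.Adj p.1 p.2).card

/-- The density `d(A,B) = e(A,B)/(|A||B|)`. -/
noncomputable def dens (G : SimpleGraph V) (A B : Finset V) : ℝ :=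
  (eAB G A B : ℝ) / ((A.card : ℝ) * (B.card : ℝ))

/-- `|Γ(x) ∩ B|`: the number of neighbors of `x` in `B`. -/
noncomputable def degIn (G : SimpleGraph V) (x : V) (B : Finset V) : ℕ :=
  (B.filter fun y => G.Adj x y).card

/-- The pair `(X,Y)` is `ε`-regular in `G`. -/
def EpsRegularPair (G : SimpleGraph V) (X Y : Finset V) (ε : ℝ) : Prop :=
  ∀ A ⊆ X, ∀ B ⊆ Y, ε * X.card < A.card → ε * Y.card < B.card →
    |dens G A B - dens G X Y| < ε

/-- The pair `(X,Y)` is `(ε,δ)`-super-regular in `G`. -/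
def SuperRegularPair (G : SimpleGraph V) (X Y : Finset V) (ε δ : ℝ) : Prop :=
  EpsRegularPair G X Y ε ∧
    (∀ x ∈ X, δ * Y.card < (degIn G x Y : ℝ)) ∧
    (∀ y ∈ Y, δ * X.card < (degIn G y X : ℝ))

/-- `G[X,Y]` has an almost `(ε,d,p,q,N)`-cover. -/
def HasAlmostCover [Fintype V] (G : SimpleGraph V) (X Y : Finset V) (ε d : ℝ) (p q N : ℕ) :
    Prop :=
  ∃ (X₀ Y₀ : Finset V) (k : ℕ) (P Q : Fin k → Finset V),
    X₀ ⊆ X ∧ Y₀ ⊆ Y ∧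
    (X₀.card : ℝ) ≤ ε * X.card ∧ (Y₀.card : ℝ) ≤ ε * Y.card ∧
    ((X₀ ∪ Y₀) ∪ Finset.univ.biUnion fun i => P i ∪ Q i) = Finset.univ ∧
    (∀ i, Disjoint (X₀ ∪ Y₀) (P i ∪ Q i)) ∧
    (∀ i j, i ≠ j → Disjoint (P i ∪ Q i) (P j ∪ Q j)) ∧
    (∀ i, Disjoint (P i) (Q i)) ∧
    (∀ i, SuperRegularPair G (P i) (Q i) ε d) ∧
    (∀ i, (P i ⊆ X ∧ Q i ⊆ Y) ∨ (P i ⊆ Y ∧ Q i ⊆ X)) ∧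
    (∀ i, q * (P i).card = p * (Q i).card ∧ N * p ≤ (P i).card)

/-- `G[X,Y]` (with `|X| = |Y| = n`) is in the extremal case with parameter `a`:
there are `A ⊆ X`, `B ⊆ Y` with `|A| = |B| = ⌊wn/h⌋` and `d(A,B) ≤ a`. -/
def ExtremalWith [Fintype V] (G : SimpleGraph V) (X Y : Finset V) (w h : ℕ) (a : ℝ) : Prop :=
  ∃ A ⊆ X, ∃ B ⊆ Y, A.card = w * X.card / h ∧ B.card = w * X.card / h ∧ dens G A B ≤ a

lemma exists_residues {κ : Type*} [Fintype κ] (d : κ → ℕ) (z : κ → ℤ)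
    (hz : ∑ K, z K * (d K : ℤ) = 1) (D : ℕ) (hD : 0 < D) (x : ℤ) :
    ∃ f : κ → ℕ, (∀ K, f K < D) ∧ (D : ℤ) ∣ x - ((∑ K, f K * d K : ℕ) : ℤ) := by
  have hD' : (0 : ℤ) < D := by exact_mod_cast hD
  refine ⟨fun K => ((x * z K) % D).toNat, fun K => ?_, ?_⟩
  · have := Int.emod_lt_of_pos (x * z K) hD'
    have := Int.emod_nonneg (x * z K) hD'.ne'
    show ((x * z K) % D).toNat < D
    omega
  · have h1 : x = ∑ K, (x * z K) * (d K : ℤ) := by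
      simp_rw [mul_assoc]
      rw [← Finset.mul_sum, hz, mul_one]
    push_cast
    conv_rhs => enter [1]; rw [h1]
    rw [← Finset.sum_sub_distrib]
    refine Finset.dvd_sum fun K _ => ?_
    rw [Int.toNat_of_nonneg (Int.emod_nonneg _ hD'.ne'), ← sub_mul]
    exact Dvd.dvd.mul_right (Int.dvd_self_sub_emod) _

lemma sum_fin_ite_lt (D f p q : ℕ) (hf : f ≤ D) :
    ∑ i : Fin D, (bif decide ((i : ℕ) < f) then p else q) = f * p + (D - f) * q := by
  have h1 : (Finset.univ.filter fun i : Fin D => (i : ℕ) < f).card = f := by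
    rw [Fin.card_filter_val_lt, min_eq_right hf]
  have h2 : (Finset.univ.filter fun i : Fin D => ¬ (i : ℕ) < f).card = D - f := by
    have := Finset.card_filter_add_card_filter_not (s := Finset.univ) (fun i : Fin D => (i : ℕ) < f)
    rw [h1, Finset.card_univ, Fintype.card_fin] at this
    omega
  simp only [Bool.cond_decide]
  rw [Finset.sum_ite, Finset.sum_const, Finset.sum_const, h1, h2, smul_eq_mul, smul_eq_mul]

/-- Flipping suitable components in `k` copies shifts the total size of the heavy color class
by a prescribed amount `x`, leaving at least `e` copies unflipped. -/
lemma exists_flips {κ : Type*} [Fintype κ] (W U : κ → ℕ) (hUW : ∀ K, U K ≤ W K) (w u : ℕ)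
    (hw : ∑ K, W K = w) (hu : ∑ K, U K = u) (z : κ → ℤ)
    (hz : ∑ K, z K * ((W K - U K : ℕ) : ℤ) = 1) (huw : u < w) (k x e : ℕ)
    (hx : (w - u) * (w - u) ≤ x) (hk : x + (w - u) + e ≤ k) :
    ∃ (J : Type) (_ : Fintype J) (F : J → κ → Bool) (ι : Fin e → J),
      Function.Injective ι ∧ (∀ i K, F (ι i) K = false) ∧ Fintype.card J = k ∧
      (∑ j, ∑ K, (bif F j K then U K else W K)) + x = w * k ∧
      ∑ j, ∑ K, (bif F j K then W K else U K) = u * k + x := by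
  obtain ⟨D, rfl⟩ : ∃ D, w = u + D := ⟨w - u, by omega⟩
  have hD : 0 < D := by omega
  simp only [Nat.add_sub_cancel_left] at hx hk
  have hd : ∑ K, (W K - U K) = D := by
    have : ∑ K, (W K - U K) + ∑ K, U K = ∑ K, W K := by
      rw [← Finset.sum_add_distrib]
      exact Finset.sum_congr rfl fun K _ => Nat.sub_add_cancel (hUW K)
    omega
  obtain ⟨f, hf, hdvd⟩ := exists_residues (fun K => W K - U K) z hz D hD x
  set S := ∑ K, f K * (W K - U K) with hS
  have hSx : S ≤ x := by
    refine le_trans ?_ hx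
    calc S ≤ ∑ K, D * (W K - U K) :=
          Finset.sum_le_sum fun K _ => Nat.mul_le_mul_right _ (hf K).le
      _ = D * D := by rw [← Finset.mul_sum, hd]
  have hdvd' : D ∣ x - S := by
    have : ((x - S : ℕ) : ℤ) = (x : ℤ) - (S : ℤ) := by push_cast [hSx]; rfl
    exact Int.natCast_dvd_natCast.1 (by rw [this]; exact hdvd)
  obtain ⟨q, hq⟩ := hdvd'
  have hqx : q ≤ x := by nlinarith [Nat.sub_le x S]
  obtain ⟨r, rfl⟩ : ∃ r, k = D + q + r + e := ⟨k - (D + q + e), by omega⟩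
  have key1 : ∑ i : Fin D, ∑ K, (bif decide ((i : ℕ) < f K) then U K else W K) + S
      = (u + D) * D := by
    rw [Finset.sum_comm, hS, ← Finset.sum_add_distrib, ← hw, Finset.sum_mul]
    refine Finset.sum_congr rfl fun K _ => ?_
    rw [sum_fin_ite_lt _ _ _ _ (hf K).le]
    obtain ⟨a, ha⟩ := Nat.exists_eq_add_of_le (hUW K)
    obtain ⟨b, hb⟩ := Nat.exists_eq_add_of_le (hf K).le
    rw [ha]
    simp only [Nat.add_sub_cancel_left, hb]
    ring
  have key2 : ∑ i : Fin D, ∑ K, (bif decide ((i : ℕ) < f K) then W K else U K)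
      = u * D + S := by
    rw [Finset.sum_comm, hS, ← hu, Finset.sum_mul, ← Finset.sum_add_distrib]
    refine Finset.sum_congr rfl fun K _ => ?_
    rw [sum_fin_ite_lt _ _ _ _ (hf K).le]
    obtain ⟨a, ha⟩ := Nat.exists_eq_add_of_le (hUW K)
    obtain ⟨b, hb⟩ := Nat.exists_eq_add_of_le (hf K).le
    rw [ha]
    simp only [Nat.add_sub_cancel_left, hb]
    ring
  have hxS : x = S + D * q := by omega
  refine ⟨(Fin D ⊕ Fin q) ⊕ (Fin r ⊕ Fin e), inferInstance,
    Sum.elim (Sum.elim (fun i K => decide ((i : ℕ) < f K)) fun _ _ => true) fun _ _ => false,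
    fun i => Sum.inr (Sum.inr i), fun a b hab => by simpa using hab, fun i K => rfl,
    by simp; ring, ?_, ?_⟩
  · simp only [Fintype.sum_sum_type, Sum.elim_inl, Sum.elim_inr, cond_true, cond_false,
      hw, hu, Finset.sum_const, Finset.card_univ, Fintype.card_sum,
      Fintype.card_fin, smul_eq_mul]
    rw [hxS]
    linear_combination key1
  · simp only [Fintype.sum_sum_type, Sum.elim_inl, Sum.elim_inr, cond_true, cond_false,
      hw, hu, Finset.sum_const, Finset.card_univ, Fintype.card_sum,
      Fintype.card_fin, smul_eq_mul]
    rw [hxS]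
    linear_combination key2

/-- A consequence of Hall's theorem: a nearly complete relation between finite types contains a
matching saturating the smaller side. -/
lemma exists_injective_of_nearly_complete {S T : Type*} [Fintype S] [Fintype T]
    (r : S → T → Prop) (D : ℕ) (hST : Fintype.card S ≤ Fintype.card T)
    (hS : ∀ s, (Finset.univ.filter fun t => ¬ r s t).card ≤ D)
    (hT : ∀ t, (Finset.univ.filter fun s => ¬ r s t).card ≤ D)
    (hD : 2 * D ≤ Fintype.card T) :
    ∃ f : S → T, Function.Injective f ∧ ∀ s, r s (f s) := by
  have hall : ∀ A : Finset S,
      A.card ≤ (A.biUnion fun s => Finset.univ.filter fun t => r s t).card := by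
    intro A
    rcases A.eq_empty_or_nonempty with rfl | ⟨s, hs⟩
    · simp
    by_cases hA : A.card ≤ D
    · have h1 := Finset.card_filter_add_card_filter_not (s := Finset.univ) (fun t => r s t)
      rw [Finset.card_univ] at h1
      have h2 := hS s
      have h3 : (Finset.univ.filter fun t => r s t) ⊆
          A.biUnion fun s => Finset.univ.filter fun t => r s t :=
        Finset.subset_biUnion_of_mem (fun s => Finset.univ.filter fun t => r s t) hs
      have := Finset.card_le_card h3
      omega
    · have : (A.biUnion fun s => Finset.univ.filter fun t => r s t) = Finset.univ := by
        ext t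
        simp only [Finset.mem_biUnion, Finset.mem_filter, Finset.mem_univ, true_and, iff_true]
        by_contra! hcon
        have : A ⊆ Finset.univ.filter fun s => ¬ r s t := fun s hs => by simp [hcon s hs]
        have := Finset.card_le_card this
        have := hT t
        omega
      rw [this, Finset.card_univ]
      exact (Finset.card_le_univ A).trans hST
  obtain ⟨f, hf, hf'⟩ := (Finset.all_card_le_biUnion_card_iff_exists_injective _).1 hall
  exact ⟨f, hf, fun s => by simpa using hf' s⟩

/-- Disjoint systems of neighbors: if each `t i` is large, then distinct representatives exist. -/
lemma exists_injective_of_card_le {S T : Type*} [Fintype S] (t : S → Finset T)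
    (ht : ∀ s, Fintype.card S ≤ (t s).card) :
    ∃ f : S → T, Function.Injective f ∧ ∀ s, f s ∈ t s := by
  refine (Finset.all_card_le_biUnion_card_iff_exists_injective _).1 fun A => ?_
  rcases A.eq_empty_or_nonempty with rfl | ⟨s, hs⟩
  · simp
  · exact (Finset.card_le_univ A).trans
      ((ht s).trans (Finset.card_le_card (Finset.subset_biUnion_of_mem t hs)))

/-- Placing the heavy and the light slots of a family of copies into a nearly complete pair
`(P, Q)`, where each exceptional vertex `e ∈ E` goes to a prescribed slot and the heavy slots of
its copy are filled with neighbors of `e`. -/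
lemma exists_pair_embedding {J α V : Type*} [Fintype α] [Nonempty V]
    (G : SimpleGraph V) (heavy light : Finset (J × α)) (hdisj : Disjoint heavy light)
    (P Q E : Finset V) (hP : heavy.card = P.card) (hQ : light.card = Q.card) (hEQ : E ⊆ Q)
    (ι : V → J) (hι : Set.InjOn ι E) (a₀ : α) (ha₀ : ∀ e ∈ E, (ι e, a₀) ∈ light)
    (star : V → α → V) (hstarP : ∀ e ∈ E, ∀ a, star e a ∈ P)
    (hstarG : ∀ e ∈ E, ∀ a, G.Adj (star e a) e)
    (hstar : ∀ e ∈ E, ∀ e' ∈ E, ∀ a a', star e a = star e' a' → e = e' ∧ a = a')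
    (D : ℕ) (hD1 : ∀ p ∈ P, ((Q \ E).filter fun q => ¬ G.Adj p q).card ≤ D)
    (hD2 : ∀ q ∈ Q \ E, (P.filter fun p => ¬ G.Adj p q).card ≤ D)
    (hD : 2 * (Fintype.card α * D) + E.card ≤ Q.card) :
    ∃ f : J × α → V, (∀ s ∈ heavy, f s ∈ P) ∧ (∀ s ∈ light, f s ∈ Q) ∧
      Set.InjOn f heavy ∧ Set.InjOn f light ∧
      ∀ j a b, (j, a) ∈ heavy → (j, b) ∈ light → G.Adj (f (j, a)) (f (j, b)) := by
  obtain ⟨g, hg⟩ := Finset.exists_equiv_extend_of_card_eq (α := heavy) (t := P)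
    (by simpa using hP) (s := Finset.univ.filter fun s => ∃ e ∈ E, ι e = s.1.1)
    (f := fun s => star (Function.invFunOn ι E s.1.1) s.1.2) (by
      intro v hv
      simp only [Finset.mem_image, Finset.mem_filter, Finset.mem_univ, true_and] at hv
      obtain ⟨s, hs, rfl⟩ := hv
      exact hstarP _ (Function.invFunOn_mem (s := (E : Set V)) (by simpa using hs)) _) (by
      intro s hs s' hs' h
      simp only [Finset.coe_filter, Finset.mem_univ, true_and, Set.mem_ofPred_eq] at hs hs'
      have h1 := Function.invFunOn_mem (f := ι) (s := (E : Set V)) (b := s.1.1) (by simpa using hs)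
      have h2 := Function.invFunOn_mem (f := ι) (s := (E : Set V)) (b := s'.1.1) (by simpa using hs')
      have h3 := Function.invFunOn_eq (f := ι) (s := (E : Set V)) (b := s.1.1) (by simpa using hs)
      have h4 := Function.invFunOn_eq (f := ι) (s := (E : Set V)) (b := s'.1.1) (by simpa using hs')
      obtain ⟨h5, h6⟩ := hstar _ h1 _ h2 _ _ h
      refine Subtype.ext (Prod.ext ?_ h6)
      rw [← h3, ← h4, h5])
  have hgE : ∀ e ∈ E, ∀ a (ha : (ι e, a) ∈ heavy), G.Adj (g ⟨(ι e, a), ha⟩ : V) e := by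
    intro e he a ha
    rw [hg ⟨(ι e, a), ha⟩ (by simpa using ⟨e, he, rfl⟩)]
    have h1 : Function.invFunOn ι E (ι e) = e :=
      hι (Function.invFunOn_mem (s := (E : Set V)) ⟨e, he, rfl⟩) he
        (Function.invFunOn_eq (s := (E : Set V)) ⟨e, he, rfl⟩)
    simp only [h1]
    exact hstarG e he a
  set des : Finset (J × α) := E.image fun e => (ι e, a₀) with hdes
  have hdesl : des ⊆ light := by
    intro s hs
    obtain ⟨e, he, rfl⟩ := Finset.mem_image.1 hs
    exact ha₀ e he
  have hdesc : des.card = E.card := Finset.card_image_of_injOn fun e he e' he' h =>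
    hι he he' (Prod.ext_iff.1 h).1
  have hcS : Fintype.card (light \ des : Finset (J × α)) = Q.card - E.card := by
    rw [Fintype.card_coe, Finset.card_sdiff_of_subset hdesl, hdesc, hQ]
  have hcT : Fintype.card (Q \ E : Finset V) = Q.card - E.card := by
    rw [Fintype.card_coe, Finset.card_sdiff_of_subset hEQ]
  obtain ⟨f, hf, hfr⟩ := exists_injective_of_nearly_complete
    (S := (light \ des : Finset (J × α))) (T := (Q \ E : Finset V))
    (fun s q => ∀ a (ha : (s.1.1, a) ∈ heavy), G.Adj (g ⟨(s.1.1, a), ha⟩ : V) q)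
    (Fintype.card α * D) (by rw [hcS, hcT]) (fun s => by
      have hsub : ((Finset.univ.filter fun q : (Q \ E : Finset V) =>
          ¬ ∀ a (ha : (s.1.1, a) ∈ heavy), G.Adj (g ⟨(s.1.1, a), ha⟩ : V) q).image
            Subtype.val) ⊆ Finset.univ.biUnion fun a : α =>
          if ha : (s.1.1, a) ∈ heavy then
            (Q \ E).filter fun q => ¬ G.Adj (g ⟨(s.1.1, a), ha⟩ : V) q else ∅ := by
        intro v hv
        obtain ⟨q, hq, rfl⟩ := Finset.mem_image.1 hv
        simp only [Finset.mem_filter, Finset.mem_univ, true_and, not_forall] at hq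
        obtain ⟨a, ha, hq⟩ := hq
        refine Finset.mem_biUnion.2 ⟨a, Finset.mem_univ _, ?_⟩
        rw [dif_pos ha]
        exact Finset.mem_filter.2 ⟨q.2, hq⟩
      have := Finset.card_le_card hsub
      rw [Finset.card_image_of_injective _ Subtype.val_injective] at this
      refine (le_of_eq (by congr)).trans
        (this.trans (Finset.card_biUnion_le_card_mul _ _ D fun a _ => ?_))
      split_ifs with ha
      · exact hD1 _ (g ⟨(s.1.1, a), ha⟩).2
      · simp) (fun q => by
      have hsub : ((Finset.univ.filter fun s : (light \ des : Finset (J × α)) =>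
          ¬ ∀ a (ha : (s.1.1, a) ∈ heavy), G.Adj (g ⟨(s.1.1, a), ha⟩ : V) q).image
            Subtype.val) ⊆ ((P.filter fun p => ¬ G.Adj p q).attach.biUnion fun p =>
          Finset.univ.image fun b : α =>
            ((g.symm ⟨p.1, (Finset.mem_filter.1 p.2).1⟩).1.1, b)) := by
        intro v hv
        obtain ⟨s, hs, rfl⟩ := Finset.mem_image.1 hv
        simp only [Finset.mem_filter, Finset.mem_univ, true_and, not_forall] at hs
        obtain ⟨a, ha, hs⟩ := hs
        refine Finset.mem_biUnion.2 ⟨⟨(g ⟨(s.1.1, a), ha⟩ : V), Finset.mem_filter.2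
          ⟨(g ⟨(s.1.1, a), ha⟩).2, hs⟩⟩, Finset.mem_attach _ _, ?_⟩
        simp only [Subtype.coe_eta, Equiv.symm_apply_apply, Finset.mem_image, Finset.mem_univ,
          true_and]
        exact ⟨s.1.2, rfl⟩
      have := Finset.card_le_card hsub
      rw [Finset.card_image_of_injective _ Subtype.val_injective] at this
      refine (le_of_eq (by congr)).trans (this.trans ((Finset.card_biUnion_le_card_mul _ _ (Fintype.card α)
        fun p _ => Finset.card_image_le).trans ?_))
      rw [Finset.card_attach, mul_comm]
      exact Nat.mul_le_mul_left _ (hD2 q q.2)) (by rw [hcT]; omega)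
  have hdes' : ∀ s ∈ light, s ∉ light \ des →
      Function.invFunOn ι E s.1 ∈ E ∧ s = (ι (Function.invFunOn ι E s.1), a₀) := by
    intro s hs h
    have h1 : s ∈ des := by simpa [hs] using h
    obtain ⟨e, he, rfl⟩ := Finset.mem_image.1 h1
    refine ⟨Function.invFunOn_mem (s := (E : Set V)) ⟨e, he, rfl⟩, ?_⟩
    rw [Function.invFunOn_eq (f := ι) (s := (E : Set V)) ⟨e, he, rfl⟩]
  refine ⟨fun s => if hs : s ∈ heavy then g ⟨s, hs⟩ else
    if hs : s ∈ light \ des then f ⟨s, hs⟩ else Function.invFunOn ι E s.1, ?_, ?_, ?_, ?_, ?_⟩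
  · intro s hs
    simp only [dif_pos hs]
    exact (g ⟨s, hs⟩).2
  · intro s hs
    have hs' : s ∉ heavy := fun h => Finset.disjoint_left.1 hdisj h hs
    simp only [dif_neg hs']
    split_ifs with h
    · exact (Finset.mem_sdiff.1 (f ⟨s, h⟩).2).1
    · exact hEQ (hdes' s hs h).1
  · intro s hs s' hs' h
    rw [Finset.mem_coe] at hs hs'
    simp only [dif_pos hs, dif_pos hs'] at h
    simpa using g.injective (Subtype.ext h)
  · intro s hs s' hs' h
    rw [Finset.mem_coe] at hs hs'
    have hs1 : s ∉ heavy := fun h => Finset.disjoint_left.1 hdisj h hs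
    have hs1' : s' ∉ heavy := fun h => Finset.disjoint_left.1 hdisj h hs'
    simp only [dif_neg hs1, dif_neg hs1'] at h
    split_ifs at h with h1 h2 h2
    · simpa using hf (Subtype.ext h)
    · exact absurd (h ▸ (hdes' s' hs' h2).1) (Finset.mem_sdiff.1 (f ⟨s, h1⟩).2).2
    · exact absurd (h ▸ (hdes' s hs h1).1) (Finset.mem_sdiff.1 (f ⟨s', h2⟩).2).2
    · obtain ⟨-, h3⟩ := hdes' s hs h1
      obtain ⟨-, h4⟩ := hdes' s' hs' h2
      rw [h3, h4, h]
  · intro j a b ha hb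
    have hb' : (j, b) ∉ heavy := fun h => Finset.disjoint_left.1 hdisj h hb
    simp only [dif_pos ha, dif_neg hb']
    split_ifs with h
    · exact hfr ⟨(j, b), h⟩ a ha
    · obtain ⟨h1, h2⟩ := hdes' _ hb h
      have h3 : j = ι (Function.invFunOn ι E j) := (Prod.ext_iff.1 h2).1
      have h4 : (ι (Function.invFunOn ι E j), a) ∈ heavy := h3 ▸ ha
      have h5 := hgE _ h1 a h4
      have h6 : g ⟨(ι (Function.invFunOn ι E j), a), h4⟩ = g ⟨(j, a), ha⟩ := by
        congr 3
        exact h3.symm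
      rw [h6] at h5
      exact h5

/-- A layout of a copy of `H` in two vertex-disjoint bipartite pairs: the first coordinate is the
pair containing the vertex, the second one tells whether it lies on the heavy side. -/
def IsLayout (H : SimpleGraph α) (l : α → Bool × Bool) : Prop :=
  ∀ ⦃a b : α⦄, H.Adj a b → (l a).1 = (l b).1 ∧ (l a).2 ≠ (l b).2

/-- The layout determined by the coloring `g`, the distribution `S` of the components to the two
pairs, and the set `F` of components whose colors are swapped. -/
def componentLayout (H : SimpleGraph α) (g : α → Bool) (S F : H.ConnectedComponent → Bool) :
    α → Bool × Bool :=
  fun a => (S (H.connectedComponentMk a), xor (F (H.connectedComponentMk a)) (g a))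

lemma isLayout_componentLayout {H : SimpleGraph α} {g : α → Bool} (hg : Proper2Coloring H g)
    (S F : H.ConnectedComponent → Bool) : IsLayout H (componentLayout H g S F) := by
  intro a b hab
  have h1 : H.connectedComponentMk a = H.connectedComponentMk b :=
    SimpleGraph.ConnectedComponent.sound hab.reachable
  refine ⟨by simp [componentLayout, h1], ?_⟩
  simpa [componentLayout, h1] using hg hab

/-- The number of vertices of color `i` in the component `K`. -/
noncomputable def compColorCard [Fintype α] (H : SimpleGraph α) (g : α → Bool) (i : Bool)
    (K : H.ConnectedComponent) : ℕ :=
  (Finset.univ.filter fun a => H.connectedComponentMk a = K ∧ g a = i).card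

lemma card_componentLayout [Fintype α] (H : SimpleGraph α) (g : α → Bool)
    (S F : H.ConnectedComponent → Bool) (p i : Bool) :
    (Finset.univ.filter fun a => componentLayout H g S F a = (p, i)).card =
      ∑ K, bif (S K == p) then
        (bif F K then compColorCard H g (!i) K else compColorCard H g i K) else 0 := by
  rw [Finset.card_eq_sum_card_fiberwise (f := H.connectedComponentMk) (t := Finset.univ)
    (fun _ _ => by simp)]
  refine Finset.sum_congr rfl fun K _ => ?_
  rw [Finset.filter_filter]
  by_cases hS : S K = p
  · rw [show (S K == p) = true by simpa using hS, cond_true]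
    unfold compColorCard
    cases hF : F K
    · rw [cond_false]
      congr 1
      ext a
      simp only [Finset.mem_filter, Finset.mem_univ, true_and, componentLayout, Prod.mk.injEq]
      constructor
      · rintro ⟨⟨h1, h2⟩, rfl⟩
        simpa [hF] using h2
      · rintro ⟨rfl, h2⟩
        simp [hF, hS, h2]
    · rw [cond_true]
      congr 1
      ext a
      simp only [Finset.mem_filter, Finset.mem_univ, true_and, componentLayout, Prod.mk.injEq]
      constructor
      · rintro ⟨⟨h1, h2⟩, rfl⟩
        rw [hF] at h2
        simp [← h2]
      · rintro ⟨rfl, h2⟩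
        simp [hF, hS, h2]
  · rw [show (S K == p) = false by simpa using hS, cond_false, Finset.card_eq_zero]
    refine Finset.filter_eq_empty_iff.2 fun a _ => ?_
    rintro ⟨h1, rfl⟩
    exact hS (Prod.ext_iff.1 h1).1

lemma sum_fin_cond_beq (D f q : ℕ) (p : Bool) (hf : f ≤ D) :
    ∑ i : Fin D, (bif (decide ((i : ℕ) < f) == p) then q else 0) =
      (bif p then f else D - f) * q := by
  cases p
  · simpa [Bool.cond_not] using sum_fin_ite_lt D f 0 q hf
  · simpa using sum_fin_ite_lt D f q 0 hf

/-- The number `k` of copies of `H` in a pair with `a` heavy and `b` light vertices, of which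
`t₁` and `t₂` are reserved, and the amount `x` by which the pair is more balanced than `w : u`. -/
lemma exists_copy_number (w u h : ℕ) (hh : w + u = h) (huw : u < w) (a b t₁ t₂ e' : ℕ)
    (h1 : t₁ ≤ h * w) (h2 : t₂ ≤ h * u) (h3 : u * a + h ^ 3 ≤ w * b)
    (h4 : w * b + h * e' + 3 * h ^ 3 ≤ a + b + u * a)
    (hdvd : (h : ℤ) ∣ ((a + b : ℕ) : ℤ) - ((t₁ + t₂ : ℕ) : ℤ)) :
    ∃ k x : ℕ, (w - u) * (w - u) ≤ x ∧ x + (w - u) + e' ≤ k ∧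
      a + x = w * k + t₁ ∧ b = u * k + x + t₂ := by
  obtain ⟨D, rfl⟩ := Nat.exists_eq_add_of_lt huw
  obtain ⟨D, rfl⟩ : ∃ D', D' = D + 1 := ⟨_, rfl⟩
  subst hh
  obtain ⟨k, hk⟩ := hdvd
  have h5 : u + D + 1 - u = D + 1 := by omega
  rw [h5]
  zify at h1 h2 h3 h4 ⊢
  push_cast at hk
  set hz : ℤ := (u : ℤ) + D + 1 + u with hhz
  have hz1 : 1 ≤ hz := by omega
  have e1 : hz * ((u + D + 1) * k + t₁ - a) = (u + D + 1) * b - u * a - (u + D + 1) * t₂ + u * t₁ := by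
    rw [hhz]; rw [hhz] at hk
    linear_combination -(u + D + 1 : ℤ) * hk
  have ht1 : (0 : ℤ) ≤ t₁ := by positivity
  have ht2 : (0 : ℤ) ≤ t₂ := by positivity
  have hu0 : (0 : ℤ) ≤ u := by positivity
  have hD0 : (0 : ℤ) ≤ D := by positivity
  have e2 : ((D : ℤ) + 1) * (D + 1) ≤ (u + D + 1) * k + t₁ - a := by
    refine le_of_mul_le_mul_left ?_ (show (0 : ℤ) < hz by omega)
    rw [e1]
    have : (u + D + 1) * (t₂ : ℤ) ≤ (u + D + 1) * (hz * u) :=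
      mul_le_mul_of_nonneg_left h2 (by positivity)
    have h6 : (0 : ℤ) ≤ u * t₁ := by positivity
    have h7 : hz * ((D + 1) * (D + 1)) + (u + D + 1) * (hz * u) ≤ hz ^ 3 := by
      have : hz ^ 3 - (hz * ((D + 1) * (D + 1)) + (u + D + 1) * (hz * u)) =
          hz * (3 * (u * (u + D + 1))) := by rw [hhz]; ring
      have : (0 : ℤ) ≤ hz * (3 * (u * (u + D + 1))) := by positivity
      linarith
    linarith
  have e3 : ((u + D + 1) * k + t₁ - a) + (D + 1) + e' ≤ k := by
    refine le_of_mul_le_mul_left ?_ (show (0 : ℤ) < hz by omega)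
    rw [mul_add, mul_add, e1]
    have h6 : (0 : ℤ) ≤ (u + D + 1) * t₂ := by positivity
    have h7 : u * (t₁ : ℤ) ≤ u * (hz * (u + D + 1)) := mul_le_mul_of_nonneg_left h1 hu0
    have h8 : u * (hz * (u + D + 1)) ≤ hz ^ 3 := by
      have : u * (hz * (u + D + 1)) = hz * (u * (u + D + 1)) := by ring
      rw [this, pow_succ' hz 2]
      refine mul_le_mul_of_nonneg_left ?_ (by omega)
      have : hz ^ 2 - u * (u + D + 1) = (u + D + 1) ^ 2 + u * (u + D + 1) + u ^ 2 := by
        rw [hhz]; ring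
      have : (0 : ℤ) ≤ (u + D + 1) ^ 2 + u * (u + D + 1) + u ^ 2 := by positivity
      linarith
    have h9 : hz * (D + 1) + hz * (u + D + 1) + hz * u ≤ 2 * hz ^ 3 := by
      have : hz ^ 2 ≤ hz ^ 3 := pow_le_pow_right₀ hz1 (by norm_num)
      have h10 : hz * (D + 1) ≤ hz * hz := mul_le_mul_of_nonneg_left (by omega) (by omega)
      have h11 : hz * (u + D + 1) + hz * u = hz * hz := by rw [hhz]; ring
      have h12 : hz ^ 2 = hz * hz := by ring
      linarith
    linarith
  have hx0 : 0 ≤ (u + D + 1) * k + t₁ - a := le_trans (by positivity) e2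
  have hk0 : 0 ≤ k := by omega
  refine ⟨k.toNat, ((u + D + 1) * k + t₁ - a).toNat, ?_, ?_, ?_, ?_⟩
  · rw [Int.toNat_of_nonneg hx0]; exact e2
  · rw [Int.toNat_of_nonneg hx0, Int.toNat_of_nonneg hk0]; exact e3
  · rw [Int.toNat_of_nonneg hx0, Int.toNat_of_nonneg hk0]; ring
  · rw [Int.toNat_of_nonneg hx0, Int.toNat_of_nonneg hk0]
    rw [hhz] at hk
    linear_combination hk

/-- Layouts of `m` copies of `H` with prescribed total class sizes exist, provided that both pairs
are slightly more balanced than `w : u`. At least `e p` of these copies lie entirely in the pair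
`p`, colored by `g`. -/
lemma exists_layouts [Fintype α] (H : SimpleGraph α) (g : α → Bool) (hg : Proper2Coloring H g)
    (w u h : ℕ) (hw : ∑ K, compColorCard H g true K = w) (hu : ∑ K, compColorCard H g false K = u)
    (hh : w + u = h) (hUW : ∀ K, compColorCard H g false K ≤ compColorCard H g true K)
    (zc zd : H.ConnectedComponent → ℤ)
    (hzc : ∑ K, zc K * ((compColorCard H g true K + compColorCard H g false K : ℕ) : ℤ) = 1)
    (hzd : ∑ K, zd K * ((compColorCard H g true K - compColorCard H g false K : ℕ) : ℤ) = 1)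
    (huw : u < w) (size : Bool × Bool → ℕ) (e : Bool → ℕ)
    (hdvd : h ∣ size (true, true) + size (true, false) + (size (false, true) + size (false, false)))
    (hphi : ∀ p, u * size (p, true) + h ^ 3 ≤ w * size (p, false))
    (hbig : ∀ p, w * size (p, false) + h * e p + 3 * h ^ 3 ≤
      size (p, true) + size (p, false) + u * size (p, true)) :
    ∃ (J : Type) (_ : Fintype J) (l : J → α → Bool × Bool) (ι : ∀ p, Fin (e p) → J),
      (∀ j, IsLayout H (l j)) ∧ (∀ p, Function.Injective (ι p)) ∧
      (∀ p x a, l (ι p x) a = (p, g a)) ∧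
      ∀ c, ∑ j, (Finset.univ.filter fun a => l j a = c).card = size c := by
  have hh0 : 0 < h := by omega
  obtain ⟨f, hf, hfd⟩ := exists_residues _ zc hzc h hh0
    ((size (true, true) + size (true, false) : ℕ) : ℤ)
  set E : Bool → H.ConnectedComponent → ℕ := fun p K => bif p then f K else h - f K with hE
  have hEh : ∀ p K, E p K ≤ h := by
    intro p K
    cases p
    · simp [hE]
    · simpa [hE] using (hf K).le
  set T : Bool → Bool → ℕ := fun p i => ∑ K, E p K * compColorCard H g i K with hT
  have hTw : ∀ p, T p true ≤ h * w := fun p => by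
    rw [← hw, Finset.mul_sum]
    exact Finset.sum_le_sum fun K _ => Nat.mul_le_mul_right _ (hEh p K)
  have hTu : ∀ p, T p false ≤ h * u := fun p => by
    rw [← hu, Finset.mul_sum]
    exact Finset.sum_le_sum fun K _ => Nat.mul_le_mul_right _ (hEh p K)
  have hTsum : ∀ i, T true i + T false i = h * (bif i then w else u) := by
    intro i
    simp only [hT, hE, cond_true, cond_false]
    rw [← Finset.sum_add_distrib]
    have : ∀ K, f K * compColorCard H g i K + (h - f K) * compColorCard H g i K =
        h * compColorCard H g i K := fun K => by
      rw [← add_mul, Nat.add_sub_cancel' (hf K).le]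
    simp_rw [this]
    rw [← Finset.mul_sum]
    cases i
    · rw [hu, cond_false]
    · rw [hw, cond_true]
  have hdvd1 : (h : ℤ) ∣ ((size (true, true) + size (true, false) : ℕ) : ℤ) -
      ((T true true + T true false : ℕ) : ℤ) := by
    convert hfd using 3
    simp only [hT, hE, cond_true]
    rw [← Finset.sum_add_distrib]
    exact Finset.sum_congr rfl fun K _ => by ring
  have hdvd2 : ∀ p, (h : ℤ) ∣ ((size (p, true) + size (p, false) : ℕ) : ℤ) -
      ((T p true + T p false : ℕ) : ℤ) := by
    intro p
    cases p
    · have h1 := hTsum true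
      have h2 := hTsum false
      obtain ⟨c, hc⟩ := hdvd
      obtain ⟨d, hd⟩ := hdvd1
      simp only [cond_true, cond_false] at h1 h2
      refine ⟨c - (w + u) - d, ?_⟩
      zify at hc h1 h2
      push_cast at hd ⊢
      linear_combination hc - hd - h1 - h2
    · exact hdvd1
  have hpair : ∀ p, ∃ k x : ℕ, (w - u) * (w - u) ≤ x ∧ x + (w - u) + e p ≤ k ∧
      size (p, true) + x = w * k + T p true ∧ size (p, false) = u * k + x + T p false := by
    intro p
    exact exists_copy_number w u h hh huw _ _ _ _ _ (hTw p) (hTu p) (hphi p) (hbig p) (hdvd2 p)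
  choose k x hx hk hsz1 hsz2 using hpair
  choose J hJ F ι hι hιF hJk hF1 hF2 using fun p => exists_flips _ _ hUW w u hw hu zd hzd huw
    (k p) (x p) (e p) (hx p) (hk p)
  refine ⟨Fin h ⊕ (Σ p, J p), inferInstance, Sum.elim
    (fun i => componentLayout H g (fun K => decide ((i : ℕ) < f K)) fun _ => false)
    (fun s => componentLayout H g (fun _ => s.1) (F s.1 s.2)),
    fun p x => Sum.inr ⟨p, ι p x⟩, ?_, ?_, ?_, ?_⟩
  · rintro (i | s)
    · exact isLayout_componentLayout hg (fun K => decide ((i : ℕ) < f K)) fun _ => false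
    · exact isLayout_componentLayout hg (fun _ => s.1) (F s.1 s.2)
  · intro p a b hab
    exact hι p (by simpa using hab)
  · intro p x a
    simp [componentLayout, hιF]
  · rintro ⟨p, i⟩
    rw [Fintype.sum_sum_type, Fintype.sum_sigma]
    have h1 := Finset.sum_congr (rfl : (Finset.univ : Finset (Fin h)) = _) fun j _ =>
      card_componentLayout H g (fun K => decide ((j : ℕ) < f K)) (fun _ => false) p i
    have h2 := Finset.sum_congr (rfl : (Finset.univ : Finset Bool) = _) fun q _ =>
      Finset.sum_congr (rfl : (Finset.univ : Finset (J q)) = _) fun j _ =>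
        card_componentLayout H g (fun _ => q) (F q j) p i
    refine (congrArg₂ (· + ·) h1 h2).trans ?_
    simp only [cond_false]
    rw [Finset.sum_comm]
    simp_rw [sum_fin_cond_beq _ _ _ _ (hf _).le]
    have hFi : ∑ j, ∑ K, (bif F p j K then compColorCard H g (!i) K else compColorCard H g i K) +
        T p i = size (p, i) := by
      have h1 := hF1 p
      have h2 := hF2 p
      have h3 := hsz1 p
      have h4 := hsz2 p
      cases i
      · rw [Bool.not_false]
        omega
      · rw [Bool.not_true]
        omega
    rw [← hFi, add_comm]
    congr 1
    cases p <;> simp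

lemma comps_eq_univ [Fintype α] (H : SimpleGraph α) : comps H = Finset.univ := by
  ext K
  induction K using SimpleGraph.ConnectedComponent.ind with
  | h v =>
    simp only [comps, Finset.mem_image, Finset.mem_univ, true_and, iff_true]
    exact ⟨v, rfl⟩

lemma colorCard_eq_sum [Fintype α] (H : SimpleGraph α) (g : α → Bool) (i : Bool) :
    colorCard g i = ∑ K, compColorCard H g i K := by
  unfold colorCard compColorCard
  rw [Finset.card_eq_sum_card_fiberwise (f := H.connectedComponentMk) (t := Finset.univ)
    (fun _ _ => by simp)]
  refine Finset.sum_congr rfl fun K _ => ?_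
  rw [Finset.filter_filter]
  congr 1
  ext a
  simp [and_comm]

lemma colorCard_add_colorCard [Fintype α] (g : α → Bool) :
    colorCard g true + colorCard g false = Fintype.card α := by
  unfold colorCard
  rw [← Finset.card_univ, ← Finset.card_filter_add_card_filter_not (s := Finset.univ)
    (fun v => g v = true)]
  simp

lemma compCard_eq_add [Fintype α] (H : SimpleGraph α) (g : α → Bool)
    (K : H.ConnectedComponent) :
    compCard H K = compColorCard H g true K + compColorCard H g false K := by
  unfold compCard compColorCard
  rw [← Finset.card_filter_add_card_filter_not (fun v => g v = true), Finset.filter_filter,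
    Finset.filter_filter]
  simp

lemma compDiff_eq_of_proper [Fintype α] {H : SimpleGraph α} {c g : α → Bool}
    (hc : Proper2Coloring H c) (hg : Proper2Coloring H g) (K : H.ConnectedComponent) :
    compDiff H c K = compDiff H g K := by
  have key : ∀ a b, H.Reachable a b → xor (c a) (g a) = xor (c b) (g b) := by
    rintro a b ⟨p⟩
    induction p with
    | nil => rfl
    | cons h p ih =>
      rw [← ih]
      have h1 := hc h
      have h2 := hg h
      revert h1 h2
      generalize c _ = c₁
      generalize c _ = c₂
      generalize g _ = g₁
      generalize g _ = g₂
      revert c₁ c₂ g₁ g₂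
      decide
  induction K using SimpleGraph.ConnectedComponent.ind with
  | h v =>
    have h : ∀ a, H.connectedComponentMk a = H.connectedComponentMk v →
        xor (c a) (g a) = xor (c v) (g v) := fun a ha =>
      key a v (SimpleGraph.ConnectedComponent.exact ha)
    unfold compDiff
    cases hv : xor (c v) (g v)
    · have h' : ∀ a, H.connectedComponentMk a = H.connectedComponentMk v → c a = g a := by
        intro a ha
        have := h a ha
        rw [hv] at this
        simpa using this
      have e : ∀ i, (Finset.univ.filter fun a => H.connectedComponentMk a =
          H.connectedComponentMk v ∧ c a = i) = Finset.univ.filter fun a =>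
          H.connectedComponentMk a = H.connectedComponentMk v ∧ g a = i := fun i => by
        refine Finset.filter_congr fun a _ => and_congr_right fun ha => ?_
        rw [h' a ha]
      rw [e, e]
    · have h' : ∀ a, H.connectedComponentMk a = H.connectedComponentMk v → c a = !g a := by
        intro a ha
        have := h a ha
        rw [hv] at this
        revert this
        generalize c a = c₁
        generalize g a = g₁
        revert c₁ g₁
        decide
      have e : ∀ i, (Finset.univ.filter fun a => H.connectedComponentMk a =
          H.connectedComponentMk v ∧ c a = i) = Finset.univ.filter fun a =>
          H.connectedComponentMk a = H.connectedComponentMk v ∧ g a = !i := fun i => by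
        refine Finset.filter_congr fun a _ => and_congr_right fun ha => ?_
        rw [h' a ha]
        cases i <;> cases g a <;> simp
      rw [e, e, ← Int.natAbs_neg, neg_sub]
      rfl

/-- A coloring attaining `σ(H)` is the lexicographically smaller one on each component. -/
lemma exists_minimal_coloring [Fintype α] (H : SimpleGraph α) (c : α → Bool)
    (hc : Proper2Coloring H c) :
    ∃ g : α → Bool, Proper2Coloring H g ∧ colorCard g false = sigmaBip H ∧
      ∀ K, compColorCard H g false K ≤ compColorCard H g true K := by
  obtain ⟨g, hg, hgs⟩ : ∃ g : α → Bool, Proper2Coloring H g ∧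
      colorCard g false = sigmaBip H := by
    obtain ⟨g, hg, h⟩ := Nat.sInf_mem (s := {k | ∃ c : α → Bool, Proper2Coloring H c ∧
      k = min (colorCard c true) (colorCard c false)}) ⟨_, c, hc, rfl⟩
    rcases min_cases (colorCard g true) (colorCard g false) with ⟨h1, -⟩ | ⟨h1, -⟩
    · refine ⟨fun a => !g a, fun a b hab => by simpa using hg hab, ?_⟩
      rw [sigmaBip, h, h1]
      simp [colorCard]
    · exact ⟨g, hg, by rw [sigmaBip, h, h1]⟩
  refine ⟨g, hg, hgs, fun K => ?_⟩
  by_contra! hK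
  set l := componentLayout H g (fun _ => true) fun K' => decide (K' = K) with hl
  have hl' : IsLayout H l := isLayout_componentLayout hg _ _
  have h1 : Proper2Coloring H fun a => (l a).2 := fun a b hab => (hl' hab).2
  have h2 : sigmaBip H ≤ colorCard (fun a => (l a).2) false := by
    refine le_trans ?_ (min_le_right (colorCard (fun a => (l a).2) true) _)
    unfold sigmaBip
    exact Nat.sInf_le ⟨fun a => (l a).2, h1, rfl⟩
  have h3 : colorCard (fun a => (l a).2) false =
      (Finset.univ.filter fun a => l a = (true, false)).card := by
    unfold colorCard
    congr 1
    ext a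
    simp only [Finset.mem_filter, Finset.mem_univ, true_and, hl, componentLayout, Prod.mk.injEq]
  rw [h3, hl, card_componentLayout, ← hgs, colorCard_eq_sum H] at h2
  refine absurd h2 (not_le.2 (Finset.sum_lt_sum (fun K' _ => ?_) ⟨K, Finset.mem_univ _, ?_⟩))
  · by_cases h : K' = K
    · subst h
      simpa using hK.le
    · simp [h]
  · simpa using hK

/-- An `H`-factor from a bijective family of copies. -/
lemma hasHFactor_of_bijective [Fintype α] {J V : Type*} [Fintype J] [Fintype V]
    (H : SimpleGraph α) (G : SimpleGraph V) (F : J × α → V) (hF : Function.Bijective F)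
    (hFa : ∀ j a b, H.Adj a b → G.Adj (F (j, a)) (F (j, b))) : HasHFactor H G := by
  refine ⟨Finset.univ.image fun j a => F (j, a), ⟨?_, ?_⟩, ?_⟩
  · intro k hk
    obtain ⟨j, -, rfl⟩ := Finset.mem_image.1 hk
    exact ⟨fun a b hab => (Prod.ext_iff.1 (hF.1 hab)).2, fun a b hab => hFa j a b hab⟩
  · intro k hk k' hk' hne a b hab
    obtain ⟨j, -, rfl⟩ := Finset.mem_image.1 hk
    obtain ⟨j', -, rfl⟩ := Finset.mem_image.1 hk'
    have h1 : j = j' := (Prod.ext_iff.1 (hF.1 hab)).1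
    exact hne (by rw [h1])
  · refine Finset.eq_univ_of_forall fun v => ?_
    obtain ⟨⟨j, a⟩, rfl⟩ := hF.2 v
    simp only [coveredSet, Finset.mem_biUnion, Finset.mem_image, Finset.mem_univ, true_and]
    exact ⟨_, ⟨j, rfl⟩, a, rfl⟩

/-- The embedding part of the extremal case: two disjoint nearly complete pairs, both slightly more
balanced than `w : u`, whose few exceptional vertices have disjoint stars, can be tiled. -/
lemma hasHFactor_of_pairs [Fintype α] {V : Type*} [Fintype V] (H : SimpleGraph α) (g : α → Bool)
    (hg : Proper2Coloring H g)
    (w u h : ℕ) (hw : ∑ K, compColorCard H g true K = w) (hu : ∑ K, compColorCard H g false K = u)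
    (hh : w + u = h) (hUW : ∀ K, compColorCard H g false K ≤ compColorCard H g true K)
    (zc zd : H.ConnectedComponent → ℤ)
    (hzc : ∑ K, zc K * ((compColorCard H g true K + compColorCard H g false K : ℕ) : ℤ) = 1)
    (hzd : ∑ K, zd K * ((compColorCard H g true K - compColorCard H g false K : ℕ) : ℤ) = 1)
    (huw : u < w) (hu0 : 0 < u) (G : SimpleGraph V) (part : Bool × Bool → Finset V)
    (hdisj : ∀ x y, x ≠ y → Disjoint (part x) (part y))
    (hcover : ∀ v, ∃ x, v ∈ part x) (hdvd : h ∣ Fintype.card V) (E : Bool → Finset V)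
    (hE : ∀ p, E p ⊆ part (p, false)) (star : V → α → V)
    (hstarP : ∀ p, ∀ e ∈ E p, ∀ a, star e a ∈ part (p, true))
    (hstarG : ∀ p, ∀ e ∈ E p, ∀ a, G.Adj (star e a) e)
    (hstar : ∀ p, ∀ e ∈ E p, ∀ e' ∈ E p, ∀ a a', star e a = star e' a' → e = e' ∧ a = a')
    (D : ℕ) (hD1 : ∀ p, ∀ x ∈ part (p, true),
      ((part (p, false) \ E p).filter fun q => ¬ G.Adj x q).card ≤ D)
    (hD2 : ∀ p, ∀ q ∈ part (p, false) \ E p,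
      ((part (p, true)).filter fun x => ¬ G.Adj x q).card ≤ D)
    (hD : ∀ p, 2 * (h * D) + (E p).card ≤ (part (p, false)).card)
    (hphi : ∀ p, u * (part (p, true)).card + h ^ 3 ≤ w * (part (p, false)).card)
    (hbig : ∀ p, w * (part (p, false)).card + h * (E p).card + 3 * h ^ 3 ≤
      (part (p, true)).card + (part (p, false)).card + u * (part (p, true)).card) :
    HasHFactor H G := by
  have hcard : Fintype.card α = h := by
    rw [← colorCard_add_colorCard g, colorCard_eq_sum H, colorCard_eq_sum H, hw, hu, hh]
  have hcardV : Fintype.card V = ∑ x, (part x).card := by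
    rw [← Finset.card_univ, ← Finset.card_biUnion fun x _ y _ hxy => hdisj x y hxy]
    congr 1
    ext v
    simpa using hcover v
  have hcardV' : Fintype.card V = (part (true, true)).card + (part (true, false)).card +
      ((part (false, true)).card + (part (false, false)).card) := by
    rw [hcardV, Fintype.sum_prod_type]
    simp
  obtain ⟨J, hJ, l, ι, hl, hι, hιg, hsum⟩ := exists_layouts H g hg w u h hw hu hh hUW zc zd hzc hzd
    huw (fun x => (part x).card) (fun p => (E p).card) (by rw [← hcardV']; exact hdvd) hphi hbig
  have hJ0 : Nonempty J := by
    by_contra hJ0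
    rw [not_nonempty_iff] at hJ0
    have h1 := hbig true
    rw [← hsum, ← hsum] at h1
    have : 0 < h ^ 3 := by
      have : 0 < h := by omega
      positivity
    simp at h1
    omega
  have hV0 : Nonempty V := by
    by_contra hV0
    rw [not_nonempty_iff] at hV0
    have h1 := hD true
    have h2 := hphi true
    rw [Finset.eq_empty_of_isEmpty (part (true, false)), Finset.card_empty] at h2
    have : 0 < h ^ 3 := by
      have : 0 < h := by omega
      positivity
    omega
  obtain ⟨a₀, ha₀⟩ : ∃ a₀, g a₀ = false := by
    rw [← colorCard_eq_sum H] at hu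
    have : (Finset.univ.filter fun v => g v = false).Nonempty := by
      rw [← Finset.card_pos]
      exact hu0.trans_eq hu.symm
    obtain ⟨a₀, ha₀⟩ := this
    exact ⟨a₀, (Finset.mem_filter.1 ha₀).2⟩
  have hslots : ∀ x, (Finset.univ.filter fun s : J × α => l s.1 s.2 = x).card =
      (part x).card := by
    intro x
    rw [← hsum]
    simp only [Finset.card_filter, Fintype.sum_prod_type]
  have hpair : ∀ p, ∃ f : J × α → V, (∀ i s, l s.1 s.2 = (p, i) → f s ∈ part (p, i)) ∧
      (∀ i s s', l s.1 s.2 = (p, i) → l s'.1 s'.2 = (p, i) → f s = f s' → s = s') ∧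
      ∀ j a b, l j a = (p, true) → l j b = (p, false) → G.Adj (f (j, a)) (f (j, b)) := by
    intro p
    obtain ⟨f, hf1, hf2, hf3, hf4, hf5⟩ := exists_pair_embedding G
      (Finset.univ.filter fun s : J × α => l s.1 s.2 = (p, true))
      (Finset.univ.filter fun s : J × α => l s.1 s.2 = (p, false))
      (Finset.disjoint_filter.2 fun s _ h1 h2 => by simp [h1] at h2)
      _ _ (E p) (hslots _) (hslots _) (hE p)
      (fun v => if hv : v ∈ E p then ι p ((E p).equivFin ⟨v, hv⟩) else hJ0.some)
      (fun v hv v' hv' hvv => by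
        rw [Finset.mem_coe] at hv hv'
        simp only [dif_pos hv, dif_pos hv'] at hvv
        simpa using (E p).equivFin.injective (hι p hvv))
      a₀ (fun e he => by
        simp only [dif_pos he, Finset.mem_filter, Finset.mem_univ, true_and, hιg, ha₀])
      star (hstarP p) (hstarG p) (hstar p) D (hD1 p) (hD2 p) (by rw [hcard]; exact hD p)
    simp only [Finset.mem_filter, Finset.mem_univ, true_and] at hf1 hf2 hf5
    refine ⟨f, fun i s hs => ?_, fun i s s' hs hs' hss => ?_, hf5⟩
    · cases i
      · exact hf2 s hs
      · exact hf1 s hs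
    · cases i
      · exact hf4 (by simpa using hs) (by simpa using hs') hss
      · exact hf3 (by simpa using hs) (by simpa using hs') hss
  choose f hfm hfi hfa using hpair
  set F : J × α → V := fun s => f (l s.1 s.2).1 s with hF
  have hFm : ∀ s, F s ∈ part (l s.1 s.2) := fun s => hfm _ _ s rfl
  have hFi : Function.Injective F := by
    intro s s' hss
    have h1 : l s.1 s.2 = l s'.1 s'.2 := by
      by_contra hne
      exact Finset.disjoint_left.1 (hdisj _ _ hne) (hFm s) (hss ▸ hFm s')
    simp only [hF, ← h1] at hss
    exact hfi _ _ s s' rfl h1.symm hss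
  have hFs : Function.Surjective F := by
    refine ((Fintype.bijective_iff_injective_and_card F).2 ⟨hFi, ?_⟩).2
    rw [hcardV, ← Finset.card_univ, Finset.card_eq_sum_card_fiberwise
      (f := fun s : J × α => l s.1 s.2) (t := Finset.univ) (fun _ _ => by simp)]
    exact Finset.sum_congr rfl fun x _ => hslots x
  have hFa : ∀ j a b, H.Adj a b → G.Adj (F (j, a)) (F (j, b)) := by
    intro j a b hab
    obtain ⟨h1, h2⟩ := hl j hab
    simp only [hF]
    rw [← h1]
    cases h3 : (l j a).2 <;> cases h4 : (l j b).2
    · exact absurd (h3.trans h4.symm) h2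
    · exact (hfa _ j b a (Prod.ext h1.symm h4) (Prod.ext rfl h3)).symm
    · exact hfa _ j a b (Prod.ext rfl h3) (Prod.ext h1.symm h4)
    · exact absurd (h3.trans h4.symm) h2
  exact hasHFactor_of_bijective H G F ⟨hFi, hFs⟩ hFa

lemma degIn_add_card_nonadj (G : SimpleGraph V) (x : V) (B : Finset V) :
    degIn G x B + (B.filter fun y => ¬ G.Adj x y).card = B.card :=
  Finset.card_filter_add_card_filter_not _

lemma card_filter_le_add_sdiff {V : Type*} (p : V → Prop) [DecidablePred p] (B C : Finset V) :
    (B.filter p).card ≤ (C.filter p).card + (B \ C).card := by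
  refine (Finset.card_le_card fun v hv => ?_).trans (Finset.card_union_le _ _)
  rw [Finset.mem_filter] at hv
  by_cases h : v ∈ C
  · exact Finset.mem_union_left _ (Finset.mem_filter.2 ⟨h, hv.2⟩)
  · exact Finset.mem_union_right _ (Finset.mem_sdiff.2 ⟨hv.1, h⟩)

lemma degIn_le_add_sdiff (G : SimpleGraph V) (x : V) (B C : Finset V) :
    degIn G x B ≤ degIn G x C + (B \ C).card :=
  card_filter_le_add_sdiff _ _ _

lemma degIn_sdiff_add {G : SimpleGraph V} {x : V} {B C : Finset V} (h : C ⊆ B) :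
    degIn G x (B \ C) + degIn G x C = degIn G x B := by
  unfold degIn
  rw [← Finset.card_union_of_disjoint (Finset.disjoint_filter_filter Finset.sdiff_disjoint),
    ← Finset.filter_union, Finset.sdiff_union_of_subset h]

lemma sum_degIn_comm (G : SimpleGraph V) (A B : Finset V) :
    ∑ x ∈ A, degIn G x B = ∑ y ∈ B, degIn G y A := by
  have := Finset.sum_card_bipartiteAbove_eq_sum_card_bipartiteBelow (s := A) (t := B) G.Adj
  unfold degIn
  simpa only [Finset.bipartiteAbove, Finset.bipartiteBelow, G.adj_comm] using this

lemma eAB_eq_sum (G : SimpleGraph V) (A B : Finset V) :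
    eAB G A B = ∑ x ∈ A, degIn G x B := by
  unfold eAB degIn
  simp only [Finset.card_filter, Finset.sum_product]

lemma BipartiteWith.symm [Fintype V] {G : SimpleGraph V} {X Y : Finset V}
    (h : BipartiteWith G X Y) : BipartiteWith G Y X :=
  ⟨h.disj.symm, by rw [Finset.union_comm, h.cover], fun _ _ hab => (h.cross hab).symm⟩

lemma BipartiteWith.degree_eq_degIn [Fintype V] {G : SimpleGraph V} {X Y : Finset V}
    (h : BipartiteWith G X Y) {x : V} (hx : x ∈ X) : G.degree x = degIn G x Y := by
  unfold degIn
  rw [← SimpleGraph.card_neighborFinset_eq_degree]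
  congr 1
  ext y
  rw [SimpleGraph.mem_neighborFinset, Finset.mem_filter]
  refine ⟨fun hxy => ⟨?_, hxy⟩, fun hxy => hxy.2⟩
  rcases h.cross hxy with h' | h'
  · exact h'.2
  · exact absurd h'.1 (Finset.disjoint_left.1 h.disj hx)

/-- Markov's inequality for finite sums of natural numbers. -/
lemma card_le_of_sum_le {V : Type*} (S : Finset V) (f : V → ℕ) (e t : ℕ)
    (hf : ∀ v ∈ S, e < f v) (hs : ∑ v ∈ S, f v ≤ e * t) : S.card ≤ t := by
  have h1 : S.card * (e + 1) ≤ ∑ v ∈ S, f v := by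
    rw [← smul_eq_mul]
    exact Finset.card_nsmul_le_sum _ _ _ hf
  by_contra! h
  nlinarith

/-- Cleaning up one side of a sparse pair. -/
lemma exists_sparse_side (G : SimpleGraph V) (X A₀ B₀ : Finset V) (hA₀ : A₀ ⊆ X) (e t : ℕ)
    (hdeg : ∀ y ∈ B₀, (X \ A₀).card ≤ degIn G y X) (hsparse : eAB G A₀ B₀ ≤ e * t)
    (he : 2 * e < B₀.card) :
    ∃ A E : Finset V, A ⊆ X ∧ E ⊆ X \ A ∧ (A \ A₀).card ≤ t ∧ (A₀ \ A).card ≤ t ∧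
      E.card ≤ 2 * t ∧ (∀ x ∈ A, degIn G x B₀ ≤ e) ∧ (∀ x ∈ E, e < degIn G x B₀) ∧
      ∀ x ∈ (X \ A) \ E, (B₀.filter fun y => ¬ G.Adj x y).card ≤ e := by
  have hs1 : ∑ x ∈ A₀, degIn G x B₀ ≤ e * t := by rwa [← eAB_eq_sum]
  have hs2 : ∑ x ∈ X \ A₀, (B₀.filter fun y => ¬ G.Adj x y).card ≤ e * t := by
    have h1 : ∑ x ∈ X \ A₀, degIn G x B₀ +
        ∑ x ∈ X \ A₀, (B₀.filter fun y => ¬ G.Adj x y).card = (X \ A₀).card * B₀.card := by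
      rw [← Finset.sum_add_distrib, Finset.sum_congr rfl fun x _ => degIn_add_card_nonadj G x B₀]
      simp
    have h2 : B₀.card * (X \ A₀).card ≤ ∑ y ∈ B₀, degIn G y X := by
      rw [← smul_eq_mul]
      exact Finset.card_nsmul_le_sum _ _ _ hdeg
    rw [Finset.sum_congr rfl fun y _ => (degIn_sdiff_add hA₀).symm, Finset.sum_add_distrib,
      ← sum_degIn_comm G (X \ A₀), ← sum_degIn_comm G A₀] at h2
    rw [mul_comm] at h2
    omega
  have hm1 : ∀ S ⊆ A₀, (∀ x ∈ S, e < degIn G x B₀) → S.card ≤ t := fun S hS h =>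
    card_le_of_sum_le S _ e t h ((Finset.sum_le_sum_of_subset hS).trans hs1)
  have hm2 : ∀ S ⊆ X \ A₀, (∀ x ∈ S, e < (B₀.filter fun y => ¬ G.Adj x y).card) →
      S.card ≤ t := fun S hS h =>
    card_le_of_sum_le S _ e t h ((Finset.sum_le_sum_of_subset hS).trans hs2)
  refine ⟨X.filter fun x => degIn G x B₀ ≤ e, X.filter fun x => e < degIn G x B₀ ∧
    e < (B₀.filter fun y => ¬ G.Adj x y).card, Finset.filter_subset _ _, ?_, ?_, ?_, ?_, ?_, ?_, ?_⟩
  · intro x hx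
    simp only [Finset.mem_filter, Finset.mem_sdiff] at hx ⊢
    exact ⟨hx.1, fun h => absurd h.2 (not_le.2 hx.2.1)⟩
  · refine hm2 _ (Finset.sdiff_subset_sdiff (Finset.filter_subset _ _) subset_rfl) fun x hx => ?_
    have := degIn_add_card_nonadj G x B₀
    simp only [Finset.mem_filter, Finset.mem_sdiff] at hx
    omega
  · refine hm1 _ Finset.sdiff_subset fun x hx => ?_
    simp only [Finset.mem_filter, Finset.mem_sdiff, not_and, not_le] at hx
    exact hx.2 (hA₀ hx.1)
  · rw [← Finset.card_sdiff_add_card_inter _ A₀, two_mul]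
    refine Nat.add_le_add (hm2 _ (Finset.sdiff_subset_sdiff (Finset.filter_subset _ _) subset_rfl)
      fun x hx => ?_) (hm1 _ Finset.inter_subset_right fun x hx => ?_)
    · simp only [Finset.mem_filter, Finset.mem_sdiff] at hx
      exact hx.1.2.2
    · simp only [Finset.mem_filter, Finset.mem_inter] at hx
      exact hx.1.2.1
  · intro x hx
    exact (Finset.mem_filter.1 hx).2
  · intro x hx
    exact (Finset.mem_filter.1 hx).2.1
  · intro x hx
    simp only [Finset.mem_filter, Finset.mem_sdiff, not_and, not_le, not_lt] at hx
    exact hx.2 hx.1.1 (hx.1.2 hx.1.1)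

/-- Vertices of large degree into `P` are centers of disjoint stars with leaves in `P`. -/
lemma exists_stars {α : Type*} [Fintype α] (G : SimpleGraph V) (E P : Finset V)
    (h : ∀ e ∈ E, E.card * Fintype.card α ≤ degIn G e P) :
    ∃ star : V → α → V, (∀ e ∈ E, ∀ a, star e a ∈ P) ∧ (∀ e ∈ E, ∀ a, G.Adj (star e a) e) ∧
      ∀ e ∈ E, ∀ e' ∈ E, ∀ a a', star e a = star e' a' → e = e' ∧ a = a' := by
  obtain ⟨f, hf, hf'⟩ := exists_injective_of_card_le (S := E × α)
    (fun s => P.filter fun y => G.Adj s.1 y) (fun s => by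
      rw [Fintype.card_prod, Fintype.card_coe]
      exact h _ s.1.2)
  refine ⟨fun v a => if hv : v ∈ E then f (⟨v, hv⟩, a) else v, fun e he a => ?_,
    fun e he a => ?_, fun e he e' he' a a' heq => ?_⟩
  · simp only [dif_pos he]
    exact (Finset.mem_filter.1 (hf' (⟨e, he⟩, a))).1
  · simp only [dif_pos he]
    exact (Finset.mem_filter.1 (hf' (⟨e, he⟩, a))).2.symm
  · simp only [dif_pos he, dif_pos he'] at heq
    simpa using hf heq

/-- A pair with many edges and small maximum degree contains many disjoint stars. -/
lemma exists_star_centers {α : Type*} [Fintype α] [Nonempty α] (G : SimpleGraph V) (Δ N : ℕ) :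
    ∀ A B : Finset V, (∀ x ∈ A, degIn G x B ≤ Δ) → (∀ y ∈ B, degIn G y A ≤ Δ) →
      Fintype.card α * A.card + N * ((Fintype.card α + 1) * Δ) <
        ∑ x ∈ A, degIn G x B + A.card →
    ∃ C ⊆ A, C.card = N ∧ ∃ star : V → α → V, (∀ e ∈ C, ∀ a, star e a ∈ B) ∧
      (∀ e ∈ C, ∀ a, G.Adj (star e a) e) ∧
      ∀ e ∈ C, ∀ e' ∈ C, ∀ a a', star e a = star e' a' → e = e' ∧ a = a' := by
  induction N with
  | zero =>
    intro A B _ _ _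
    exact ⟨∅, by simp, rfl, fun v _ => v, by simp, by simp, by simp⟩
  | succ N ih =>
    intro A B hA hB hsum
    obtain ⟨x, hx, hxd⟩ : ∃ x ∈ A, Fintype.card α ≤ degIn G x B := by
      by_contra! hlt
      have h1 : ∑ x ∈ A, (degIn G x B + 1) ≤ A.card * Fintype.card α := by
        rw [← smul_eq_mul]
        exact Finset.sum_le_card_nsmul _ _ _ hlt
      rw [Finset.sum_add_distrib, Finset.sum_const, smul_eq_mul, mul_one, mul_comm] at h1
      have := Nat.zero_le ((N + 1) * ((Fintype.card α + 1) * Δ))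
      omega
    obtain ⟨L, hL, hLc⟩ := Finset.exists_subset_card_eq hxd
    have hLB : L ⊆ B := hL.trans (Finset.filter_subset _ _)
    have h1 : ∑ x' ∈ A.erase x, degIn G x' B + degIn G x B = ∑ x' ∈ A, degIn G x' B :=
      Finset.sum_erase_add _ _ hx
    have h2 : ∑ x' ∈ A.erase x, degIn G x' (B \ L) + ∑ x' ∈ A.erase x, degIn G x' L =
        ∑ x' ∈ A.erase x, degIn G x' B := by
      rw [← Finset.sum_add_distrib]
      exact Finset.sum_congr rfl fun _ _ => degIn_sdiff_add hLB
    have hmono : ∀ v {S T : Finset V}, S ⊆ T → degIn G v S ≤ degIn G v T := fun v S T h =>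
      Finset.card_le_card (Finset.filter_subset_filter _ h)
    have h3 : ∑ x' ∈ A.erase x, degIn G x' L ≤ Fintype.card α * Δ := by
      rw [sum_degIn_comm, ← hLc, ← smul_eq_mul]
      exact Finset.sum_le_card_nsmul _ _ _ fun y hy =>
        (hmono y (Finset.erase_subset _ _)).trans (hB y (hLB hy))
    have h4 := hA x hx
    have h5 := Finset.card_erase_add_one hx
    obtain ⟨C, hC, hCN, star, hs1, hs2, hs3⟩ := ih (A.erase x) (B \ L)
      (fun v hv => (hmono v Finset.sdiff_subset).trans (hA v (Finset.mem_of_mem_erase hv)))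
      (fun v hv => (hmono v (Finset.erase_subset _ _)).trans (hB v (Finset.mem_sdiff.1 hv).1))
      (by
        have h6 : Fintype.card α * A.card =
          Fintype.card α * (A.erase x).card + Fintype.card α := by rw [← h5]; ring
        have h7 : (N + 1) * ((Fintype.card α + 1) * Δ) =
          N * ((Fintype.card α + 1) * Δ) + Fintype.card α * Δ + Δ := by ring
        have h8 : 1 ≤ A.card := Finset.card_pos.2 ⟨x, hx⟩
        rw [h6, h7] at hsum
        have h9 : 0 < Fintype.card α := Fintype.card_pos
        omega)
    obtain ⟨b⟩ : Nonempty (α ≃ L) := ⟨Fintype.equivOfCardEq (by rw [Fintype.card_coe, hLc])⟩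
    have hxC : ∀ e ∈ C, e ≠ x := fun e he => Finset.ne_of_mem_erase (hC he)
    refine ⟨insert x C, Finset.insert_subset hx (hC.trans (Finset.erase_subset _ _)), ?_,
      fun v a => if v = x then b a else star v a, ?_, ?_, ?_⟩
    · rw [Finset.card_insert_of_notMem fun h => hxC x h rfl, hCN]
    · intro e he a
      rcases Finset.mem_insert.1 he with rfl | he
      · simp only [if_true]
        exact hLB (b a).2
      · simp only [if_neg (hxC e he)]
        exact (Finset.mem_sdiff.1 (hs1 e he a)).1
    · intro e he a
      rcases Finset.mem_insert.1 he with rfl | he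
      · simp only [if_true]
        exact (Finset.mem_filter.1 (hL (b a).2)).2.symm
      · simp only [if_neg (hxC e he)]
        exact hs2 e he a
    · intro e he e' he' a a' heq
      rcases Finset.mem_insert.1 he with rfl | hm <;> rcases Finset.mem_insert.1 he' with rfl | hm'
      · simpa using heq
      · simp only [if_true, if_neg (hxC e' hm')] at heq
        exact absurd (heq ▸ (b a).2) (Finset.mem_sdiff.1 (hs1 e' hm' a')).2
      · simp only [if_true, if_neg (hxC e hm)] at heq
        exact absurd (heq ▸ (b a').2) (Finset.mem_sdiff.1 (hs1 e hm a)).2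
      · simp only [if_neg (hxC e hm), if_neg (hxC e' hm')] at heq
        exact hs3 e hm e' hm' a a' heq

/-- A set of star centers in `A` whose removal makes the pair `(A, B)` slightly less unbalanced than
`w : u`. -/
lemma exists_balancing_stars {α : Type*} [Fintype α] [Nonempty α] (G : SimpleGraph V)
    (X A B : Finset V) (hAX : A ⊆ X) (h w u n e t : ℕ) (hα : Fintype.card α = h) (hwu : w + u = h)
    (hX : X.card = n) (hdA : ∀ x ∈ A, degIn G x B ≤ 2 * e) (hdB : ∀ y ∈ B, degIn G y A ≤ 2 * e)
    (hdX : ∀ y ∈ B, u * n + h * (h ^ 2 + h) ≤ h * degIn G y X)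
    (hAB : A.card ≤ B.card + 4 * t) (hAt : 4 * h * t < A.card) (hBe : 4 * h ^ 2 * e ≤ B.card) :
    ∃ C ⊆ A, C.card = h * A.card + h ^ 3 - w * n ∧ ∃ star : V → α → V,
      (∀ v ∈ C, ∀ a, star v a ∈ B) ∧ (∀ v ∈ C, ∀ a, G.Adj (star v a) v) ∧
      ∀ v ∈ C, ∀ v' ∈ C, ∀ a a', star v a = star v' a' → v = v' ∧ a = a' := by
  set N := h * A.card + h ^ 3 - w * n with hN
  rcases Nat.eq_zero_or_pos N with hN0 | hN0
  · exact ⟨∅, by simp, by rw [hN0]; rfl, fun v _ => v, by simp, by simp, by simp⟩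
  have hNe : N + w * n = h * A.card + h ^ 3 := by omega
  refine exists_star_centers G (2 * e) N A B hdA hdB ?_
  have hh : 0 < h := hα ▸ Fintype.card_pos
  have h1 : B.card * (N + h ^ 2) ≤ ∑ y ∈ B, h * degIn G y A := by
    rw [← smul_eq_mul]
    refine Finset.card_nsmul_le_sum _ _ _ fun y hy => ?_
    have h2 := hdX y hy
    have h3 := degIn_le_add_sdiff G y X A
    rw [Finset.card_sdiff_of_subset hAX, hX] at h3
    have h4 : A.card ≤ n := hX ▸ Finset.card_le_card hAX
    have h5 : h * degIn G y X + h * A.card ≤ h * degIn G y A + h * n := by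
      rw [← mul_add, ← mul_add]
      exact Nat.mul_le_mul_left _ (by omega)
    have h6 : w * n + u * n = h * n := by rw [← add_mul, hwu]
    have h7 : h * (h ^ 2 + h) = h ^ 3 + h ^ 2 := by ring
    omega
  rw [← Finset.mul_sum, ← sum_degIn_comm] at h1
  rw [hα]
  refine lt_of_mul_lt_mul_left (a := h) ?_ (Nat.zero_le _)
  have h2 : N * (4 * h ^ 2 * e) ≤ N * B.card := Nat.mul_le_mul_left _ hBe
  have h3 : h * (4 * h * t) < h * A.card := Nat.mul_lt_mul_of_pos_left hAt hh
  have h4 : h ^ 2 * A.card ≤ h ^ 2 * (B.card + 4 * t) := Nat.mul_le_mul_left _ hAB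
  have h5 : N * e * h ≤ N * e * h ^ 2 := Nat.mul_le_mul_left _ (Nat.le_self_pow two_ne_zero h)
  nlinarith

/-- The properties of one side of a sparse pair `(A, B)` with `A ⊆ X`, `B ⊆ Y`, where `E` is the set
of exceptional vertices of `X \ A`. -/
structure SparseSide (G : SimpleGraph V) (X Y A B E : Finset V) (e t : ℕ) : Prop where
  subset : A ⊆ X
  exc_subset : E ⊆ X \ A
  card_exc_le : E.card ≤ 2 * t
  degIn_le : ∀ x ∈ A, degIn G x B ≤ 2 * e
  nonadj_le : ∀ x ∈ A, ((Y \ B).filter fun y => ¬ G.Adj x y).card ≤ 2 * e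
  nonadj_compl_le : ∀ x ∈ (X \ A) \ E, (B.filter fun y => ¬ G.Adj x y).card ≤ 2 * e
  le_degIn_exc : ∀ x ∈ E, e ≤ degIn G x B + t

/-- The four parts of the vertex set after moving `C` from `A` to the other side. -/
noncomputable def fourParts (X Y A B C : Finset V) : Bool × Bool → Finset V
  | (true, true) => A \ C
  | (true, false) => Y \ B
  | (false, true) => B
  | (false, false) => (X \ A) ∪ C

lemma disjoint_fourParts {X Y A B C : Finset V} (hXY : Disjoint X Y) (hA : A ⊆ X) (hB : B ⊆ Y)
    (hC : C ⊆ A) (x y : Bool × Bool) (hxy : x ≠ y) :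
    Disjoint (fourParts X Y A B C x) (fourParts X Y A B C y) := by
  rw [Finset.disjoint_left]
  intro v hx hy
  have h0 : v ∈ X → v ∉ Y := fun h => Finset.disjoint_left.1 hXY h
  have h1 : v ∈ A → v ∈ X := fun h => hA h
  have h2 : v ∈ B → v ∈ Y := fun h => hB h
  have h3 : v ∈ C → v ∈ A := fun h => hC h
  obtain ⟨_ | _, _ | _⟩ := x <;> obtain ⟨_ | _, _ | _⟩ := y <;>
    simp only [fourParts, Finset.mem_sdiff, Finset.mem_union] at hx hy <;> first
    | exact hxy rfl
    | tauto

lemma exists_mem_fourParts [Fintype V] {X Y : Finset V} (A B C : Finset V)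
    (hXY : X ∪ Y = Finset.univ) (v : V) : ∃ x, v ∈ fourParts X Y A B C x := by
  have h0 : v ∈ X ∪ Y := hXY ▸ Finset.mem_univ v
  by_cases hA : v ∈ A
  · by_cases hC : v ∈ C
    · exact ⟨(false, false), Finset.mem_union_right _ hC⟩
    · exact ⟨(true, true), Finset.mem_sdiff.2 ⟨hA, hC⟩⟩
  · by_cases hvB : v ∈ B
    · exact ⟨(false, true), hvB⟩
    · rcases Finset.mem_union.1 h0 with h | h
      · exact ⟨(false, false), Finset.mem_union_left _ (Finset.mem_sdiff.2 ⟨h, hA⟩)⟩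
      · exact ⟨(true, false), Finset.mem_sdiff.2 ⟨h, hvB⟩⟩

/-- The sizes of the four parts satisfy the inequalities required for a tiling. -/
lemma fourParts_inequalities {h w u n a b N e t x y : ℤ} (hwu : w + u = h) (hu : 1 ≤ u) (hw : 1 ≤ w)
    (ha1 : h * a ≤ w * n + 2 * h * t) (ha2 : w * n ≤ h * a + 2 * h * t)
    (hb1 : h * b ≤ w * n + 2 * h * t) (hb2 : w * n ≤ h * b + 2 * h * t) (hba : b ≤ a)
    (hN0 : 0 ≤ N) (hN1 : h * a + h ^ 3 ≤ w * n + N) (hN2 : N ≤ 3 * h * t)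
    (hn : 100 * h ^ 2 * e ≤ n) (he : 10 * h ^ 2 * t ≤ e) (ht : h ^ 2 ≤ t)
    (hx : x ≤ 2 * t) (hy : y ≤ 2 * t) :
    (2 * (h * (2 * e)) + y ≤ n - b ∧ 2 * (h * (2 * e)) + (x + N) ≤ n - a + N) ∧
    (u * (a - N) + h ^ 3 ≤ w * (n - b) ∧ u * b + h ^ 3 ≤ w * (n - a + N)) ∧
    (w * (n - b) + h * y + 3 * h ^ 3 ≤ (a - N) + (n - b) + u * (a - N) ∧
      w * (n - a + N) + h * (x + N) + 3 * h ^ 3 ≤ b + (n - a + N) + u * b) := by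
  have hh : 1 ≤ h := by linarith
  have ht0 : 0 ≤ t := le_trans (sq_nonneg h) ht
  have e1 : h * t ≤ h ^ 2 * t := by nlinarith [mul_nonneg (by linarith : (0 : ℤ) ≤ h) ht0]
  have e0 : t ≤ h * t := by nlinarith
  have e2 : h ^ 4 ≤ h ^ 2 * t := by nlinarith [mul_le_mul_of_nonneg_left ht (sq_nonneg h)]
  have e3 : h ^ 2 * t ≤ h ^ 3 * t := by nlinarith [mul_nonneg (sq_nonneg h) ht0]
  have e4 : h ^ 3 * t ≤ h ^ 2 * e := by nlinarith [mul_nonneg (sq_nonneg h) ht0]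
  have e5 : h * e ≤ h ^ 2 * e := by nlinarith
  have hub : u ≤ h := by linarith
  have hwb : w ≤ h := by linarith
  have hsum : w * n + u * n = h * n := by rw [← hwu]; ring
  have hn0 : 0 ≤ n := by nlinarith
  have hun : n ≤ u * n := by nlinarith
  have hwn : n ≤ w * n := by nlinarith
  have hh0 : 0 ≤ h := by linarith
  have hhp : 0 < h := by linarith
  have hu0 : 0 ≤ u := by linarith
  have hw0 : 0 ≤ w := by linarith
  have k1 : w * b ≤ w * a := mul_le_mul_of_nonneg_left hba hw0
  have k2 : w * a + u * a = h * a := by rw [← hwu]; ring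
  have k3 : u * b ≤ u * a := mul_le_mul_of_nonneg_left hba hu0
  have k4 : N ≤ u * N := by nlinarith
  have k5 : N ≤ w * N := by nlinarith
  have p1 : w * (w * n) ≤ w * (h * b + 2 * h * t) := mul_le_mul_of_nonneg_left hb2 hw0
  have p1' : w * (w * n) ≤ w * (h * a + 2 * h * t) := mul_le_mul_of_nonneg_left ha2 hw0
  have p2 : u * (w * n) ≤ u * (h * a + 2 * h * t) := mul_le_mul_of_nonneg_left ha2 hu0
  have p2' : u * (w * n) ≤ u * (h * b + 2 * h * t) := mul_le_mul_of_nonneg_left hb2 hu0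
  have p3 : w * (w * n + u * n) = w * (h * n) := by rw [hsum]
  have hht : 0 ≤ h * t := mul_nonneg hh0 ht0
  have hhN : 0 ≤ h * N := mul_nonneg hh0 hN0
  have q1 : w * (h * t) ≤ h * (h * t) := mul_le_mul_of_nonneg_right hwb hht
  have q2 : u * (h * t) ≤ h * (h * t) := mul_le_mul_of_nonneg_right hub hht
  have q3 : u * (h * N) ≤ h * (h * N) := mul_le_mul_of_nonneg_right hub hhN
  have q3' : w * (h * N) ≤ h * (h * N) := mul_le_mul_of_nonneg_right hwb hhN
  have q4 : h * N ≤ h * (3 * h * t) := mul_le_mul_of_nonneg_left hN2 hh0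
  have q5 : h * (h * N) ≤ h * (h * (3 * h * t)) := mul_le_mul_of_nonneg_left q4 hh0
  have q6 : h * y ≤ h * (2 * t) := mul_le_mul_of_nonneg_left hy hh0
  have q7 : h * (h * y) ≤ h * (h * (2 * t)) := mul_le_mul_of_nonneg_left q6 hh0
  have q8 : h * x ≤ h * (2 * t) := mul_le_mul_of_nonneg_left hx hh0
  have q9 : h * (h * x) ≤ h * (h * (2 * t)) := mul_le_mul_of_nonneg_left q8 hh0
  refine ⟨⟨?_, ?_⟩, ⟨by linarith, by linarith⟩, ?_, ?_⟩
  · refine le_of_mul_le_mul_left ?_ hhp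
    linarith
  · refine le_of_mul_le_mul_left ?_ hhp
    linarith
  · refine le_of_mul_le_mul_left ?_ hhp
    linarith
  · refine le_of_mul_le_mul_left ?_ hhp
    linarith

/-- A balanced bipartite graph with a sparse pair `(A, B)` of size close to `wn / h` on each side has
an `H`-factor, if `|B| ≤ |A|`. -/
lemma hasHFactor_of_sparse_sides [Fintype α] {V : Type*} [Fintype V] (H : SimpleGraph α)
    (g : α → Bool) (hg : Proper2Coloring H g)
    (w u h : ℕ) (hw : ∑ K, compColorCard H g true K = w) (hu : ∑ K, compColorCard H g false K = u)
    (hh : w + u = h) (hUW : ∀ K, compColorCard H g false K ≤ compColorCard H g true K)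
    (zc zd : H.ConnectedComponent → ℤ)
    (hzc : ∑ K, zc K * ((compColorCard H g true K + compColorCard H g false K : ℕ) : ℤ) = 1)
    (hzd : ∑ K, zd K * ((compColorCard H g true K - compColorCard H g false K : ℕ) : ℤ) = 1)
    (huw : u < w) (hu0 : 0 < u) (G : SimpleGraph V) (X Y : Finset V) (hG : BipartiteWith G X Y)
    (n e t : ℕ) (hX : X.card = n) (hY : Y.card = n) (hdvd : h ∣ Fintype.card V)
    (hdX : ∀ y ∈ Y, u * n + h * (h ^ 2 + h) ≤ h * degIn G y X)
    (A B EX EY : Finset V) (hSA : SparseSide G X Y A B EX e t) (hSB : SparseSide G Y X B A EY e t)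
    (ha1 : h * A.card ≤ w * n + 2 * h * t) (ha2 : w * n ≤ h * A.card + 2 * h * t)
    (hb1 : h * B.card ≤ w * n + 2 * h * t) (hb2 : w * n ≤ h * B.card + 2 * h * t)
    (hba : B.card ≤ A.card) (hn : 100 * h ^ 2 * e ≤ n) (he : 10 * h ^ 2 * t ≤ e) (ht : h ^ 2 ≤ t) :
    HasHFactor H G := by
  have hcard : Fintype.card α = h := by
    rw [← colorCard_add_colorCard g, colorCard_eq_sum H, colorCard_eq_sum H, hw, hu, hh]
  have hh0 : 0 < h := by omega
  have hα : Nonempty α := Fintype.card_pos_iff.1 (hcard ▸ hh0)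
  have e1 : h * t ≤ h ^ 2 * t := Nat.mul_le_mul_right _ (Nat.le_self_pow two_ne_zero h)
  have e2 : t ≤ h * t := Nat.le_mul_of_pos_left _ hh0
  have e3 : e ≤ h ^ 2 * e := Nat.le_mul_of_pos_left _ (by positivity)
  have e4 : h ^ 2 ≤ h ^ 2 * t := Nat.le_mul_of_pos_right _ (lt_of_lt_of_le (by positivity) ht)
  have hBe : 4 * h ^ 2 * e ≤ B.card := by
    have h1 : h * n ≤ 2 * w * n := Nat.mul_le_mul_right _ (by omega)
    have h2 : h * (100 * h ^ 2 * e) ≤ h * n := Nat.mul_le_mul_left _ hn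
    have h3 : h ^ 2 * e ≤ h * (h ^ 2 * e) := Nat.le_mul_of_pos_left _ hh0
    have : h * (4 * h ^ 2 * e) ≤ h * B.card := by linarith
    exact Nat.le_of_mul_le_mul_left this hh0
  have hAB : A.card ≤ B.card + 4 * t := by
    have : h * A.card ≤ h * (B.card + 4 * t) := by linarith
    exact Nat.le_of_mul_le_mul_left this hh0
  have hAt : 4 * h * t < A.card := by
    have : 0 < h ^ 2 := by positivity
    linarith
  obtain ⟨C, hCA, hC, sC, hsC1, hsC2, hsC3⟩ := exists_balancing_stars G X A B hSA.subset h w u n e t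
    hcard hh hX hSA.degIn_le hSB.degIn_le (fun y hy => hdX y (hSB.subset hy)) hAB hAt hBe
  have hCt : C.card ≤ 3 * h * t := by
    have : h ^ 3 ≤ h * t := (pow_succ' h 2).le.trans (Nat.mul_le_mul_left _ ht)
    have : 3 * h * t = 2 * h * t + h * t := by ring
    omega
  obtain ⟨sX, hsX1, hsX2, hsX3⟩ := exists_stars (α := α) G EX
    (B \ C.biUnion fun v => Finset.univ.image (sC v)) fun v hv => by
      have h1 := hSA.le_degIn_exc v hv
      have h2 := degIn_le_add_sdiff G v B (B \ C.biUnion fun v => Finset.univ.image (sC v))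
      have h3 : (B \ (B \ C.biUnion fun v => Finset.univ.image (sC v))).card ≤ C.card * h := by
        refine (Finset.card_le_card (t := C.biUnion fun v => Finset.univ.image (sC v)) ?_).trans
          (Finset.card_biUnion_le_card_mul _ _ _ fun v _ => ?_)
        · intro v hv
          by_contra h
          simp only [Finset.mem_sdiff] at hv
          exact hv.2 ⟨hv.1, h⟩
        · rw [← hcard]
          exact Finset.card_image_le
      have h4 : C.card * h ≤ 3 * h * t * h := Nat.mul_le_mul_right _ hCt
      have h5 : EX.card * h ≤ 2 * t * h := Nat.mul_le_mul_right _ hSA.card_exc_le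
      rw [hcard]
      linarith
  obtain ⟨sY, hsY1, hsY2, hsY3⟩ := exists_stars (α := α) G EY (A \ C) fun v hv => by
      have h1 := hSB.le_degIn_exc v hv
      have h2 := degIn_le_add_sdiff G v A (A \ C)
      rw [Finset.sdiff_sdiff_eq_self hCA] at h2
      have h5 : EY.card * h ≤ 2 * t * h := Nat.mul_le_mul_right _ hSB.card_exc_le
      rw [hcard]
      linarith
  have hCX : ∀ v ∈ EX, v ∉ C := fun v hv h =>
    (Finset.mem_sdiff.1 (hSA.exc_subset hv)).2 (hCA h)
  have hXY : ∀ v ∈ X, v ∉ Y := fun v hv => Finset.disjoint_left.1 hG.disj hv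
  have hEYX : ∀ v ∈ EY, v ∉ X := fun v hv h =>
    hXY v h (Finset.mem_sdiff.1 (hSB.exc_subset hv)).1
  have hYC : ∀ v ∈ EY, v ∉ C := fun v hv h => hEYX v hv (hSA.subset (hCA h))
  have hYX : ∀ v ∈ EY, v ∉ EX := fun v hv h => hEYX v hv (Finset.mem_sdiff.1 (hSA.exc_subset h)).1
  set star : V → α → V := fun v => if v ∈ C then sC v else if v ∈ EX then sX v else sY v with hstar
  have hstarC : ∀ v ∈ C, star v = sC v := fun v hv => if_pos hv
  have hstarX : ∀ v ∈ EX, star v = sX v := fun v hv => by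
    simp only [hstar, if_neg (hCX v hv), if_pos hv]
  have hstarY : ∀ v ∈ EY, star v = sY v := fun v hv => by
    simp only [hstar, if_neg (hYC v hv), if_neg (hYX v hv)]
  have hCE : ∀ v ∈ C, ∀ v' ∈ EX, ∀ a a', sC v a ≠ sX v' a' := fun v hv v' hv' a a' heq =>
    (Finset.mem_sdiff.1 (hsX1 v' hv' a')).2 (Finset.mem_biUnion.2 ⟨v, hv,
      Finset.mem_image.2 ⟨a, Finset.mem_univ _, heq⟩⟩)
  have hsubE : ((X \ A) ∪ C) \ (EX ∪ C) ⊆ (X \ A) \ EX := by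
    intro v hv
    simp only [Finset.mem_sdiff, Finset.mem_union] at hv ⊢
    tauto
  have hcX : (X \ A).card + A.card = n := by
    rw [Finset.card_sdiff_add_card_eq_card hSA.subset, hX]
  have hcY : (Y \ B).card + B.card = n := by
    rw [Finset.card_sdiff_add_card_eq_card hSB.subset, hY]
  have hcC : (A \ C).card + C.card = A.card := Finset.card_sdiff_add_card_eq_card hCA
  have hcXC : ((X \ A) ∪ C).card = (X \ A).card + C.card :=
    Finset.card_union_of_disjoint (Finset.disjoint_left.2 fun v hv h =>
      (Finset.mem_sdiff.1 hv).2 (hCA h))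
  have hcE : (EX ∪ C).card ≤ EX.card + C.card := Finset.card_union_le _ _
  obtain ⟨⟨i1, i2⟩, ⟨i3, i4⟩, i5, i6⟩ := fourParts_inequalities (h := h) (w := w) (u := u) (n := n)
    (a := A.card) (b := B.card) (N := C.card) (e := e) (t := t) (x := EX.card) (y := EY.card)
    (by exact_mod_cast hh) (by exact_mod_cast hu0) (by exact_mod_cast hu0.trans huw)
    (by exact_mod_cast ha1) (by exact_mod_cast ha2) (by exact_mod_cast hb1) (by exact_mod_cast hb2)
    (by exact_mod_cast hba) (by positivity) (by
      rw [hC]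
      have : h * A.card + h ^ 3 ≤ w * n + (h * A.card + h ^ 3 - w * n) := by omega
      exact_mod_cast this) (by exact_mod_cast hCt) (by exact_mod_cast hn) (by exact_mod_cast he)
    (by exact_mod_cast ht) (by exact_mod_cast hSA.card_exc_le) (by exact_mod_cast hSB.card_exc_le)
  have j1 : (n : ℤ) - B.card = (Y \ B).card := by rw [← hcY]; push_cast; ring
  have j2 : (n : ℤ) - A.card + C.card = ((X \ A) ∪ C).card := by
    rw [hcXC, ← hcX]; push_cast; ring
  have j3 : (A.card : ℤ) - C.card = (A \ C).card := by rw [← hcC]; push_cast; ring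
  rw [j1] at i1 i3 i5
  rw [j2] at i2 i4 i6
  rw [j3] at i3 i5
  norm_cast at i1 i2 i3 i4 i5 i6
  refine hasHFactor_of_pairs H g hg w u h hw hu hh hUW zc zd hzc hzd huw hu0 G (fourParts X Y A B C)
    (disjoint_fourParts hG.disj hSA.subset hSB.subset hCA)
    (exists_mem_fourParts A B C hG.cover) hdvd (fun p => bif p then EY else EX ∪ C)
    ?_ star ?_ ?_ ?_ (2 * e) ?_ ?_ ?_ ?_ ?_
  · rintro (_ | _)
    · exact Finset.union_subset_union_left hSA.exc_subset
    · exact hSB.exc_subset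
  · rintro (_ | _) v hv a
    · rcases Finset.mem_union.1 hv with hv | hv
      · rw [hstarX v hv]
        exact (Finset.mem_sdiff.1 (hsX1 v hv a)).1
      · rw [hstarC v hv]
        exact hsC1 v hv a
    · rw [hstarY v hv]
      exact hsY1 v hv a
  · rintro (_ | _) v hv a
    · rcases Finset.mem_union.1 hv with hv | hv
      · rw [hstarX v hv]
        exact hsX2 v hv a
      · rw [hstarC v hv]
        exact hsC2 v hv a
    · rw [hstarY v hv]
      exact hsY2 v hv a
  · rintro (_ | _) v hv v' hv' a a' heq
    · rcases Finset.mem_union.1 hv with hv | hv <;> rcases Finset.mem_union.1 hv' with hv' | hv'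
      · rw [hstarX v hv, hstarX v' hv'] at heq
        exact hsX3 v hv v' hv' a a' heq
      · rw [hstarX v hv, hstarC v' hv'] at heq
        exact absurd heq.symm (hCE v' hv' v hv a' a)
      · rw [hstarC v hv, hstarX v' hv'] at heq
        exact absurd heq (hCE v hv v' hv' a a')
      · rw [hstarC v hv, hstarC v' hv'] at heq
        exact hsC3 v hv v' hv' a a' heq
    · rw [hstarY v hv, hstarY v' hv'] at heq
      exact hsY3 v hv v' hv' a a' heq
  · rintro (_ | _) v hv
    · exact (Finset.card_le_card (Finset.filter_subset_filter _
        (hsubE.trans Finset.sdiff_subset))).trans (hSB.nonadj_le v hv)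
    · exact (Finset.card_le_card (Finset.filter_subset_filter _ Finset.sdiff_subset)).trans
        (hSA.nonadj_le v (Finset.mem_sdiff.1 hv).1)
  · rintro (_ | _) v hv
    · simp only [G.adj_comm _ v]
      exact hSA.nonadj_compl_le v (hsubE hv)
    · simp only [G.adj_comm _ v]
      exact (Finset.card_le_card (Finset.filter_subset_filter _ Finset.sdiff_subset)).trans
        (hSB.nonadj_compl_le v hv)
  · rintro (_ | _)
    · exact (Nat.add_le_add_left hcE _).trans i2
    · exact i1
  · rintro (_ | _)
    · exact i4
    · exact i3
  · rintro (_ | _)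
    · refine le_trans ?_ i6
      exact Nat.add_le_add_right (Nat.add_le_add_left (Nat.mul_le_mul_left _ hcE) _) _
    · exact i5

lemma sparseSide_of_core [Fintype V] {G : SimpleGraph V} {X Y : Finset V}
    {h w u n e t : ℕ} (hh : w + u = h) (hh0 : 0 < h) (hY : Y.card = n)
    (hdY : ∀ x ∈ X, u * n + h * (h ^ 2 + h) ≤ h * degIn G x Y) {A B B₀ E : Finset V}
    (hBY : B ⊆ Y) (hAX : A ⊆ X) (hE : E ⊆ X \ A) (hEt : E.card ≤ 2 * t)
    (hB₁ : (B \ B₀).card ≤ t) (hB₂ : (B₀ \ B).card ≤ t) (hA : ∀ x ∈ A, degIn G x B₀ ≤ e)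
    (hEe : ∀ x ∈ E, e < degIn G x B₀)
    (hc : ∀ x ∈ (X \ A) \ E, (B₀.filter fun y => ¬ G.Adj x y).card ≤ e)
    (hb2 : w * n ≤ h * B.card + 2 * h * t) (he : 3 * t ≤ e) : SparseSide G X Y A B E e t where
  subset := hAX
  exc_subset := hE
  card_exc_le := hEt
  degIn_le x hx := by
    have h1 := degIn_le_add_sdiff G x B B₀
    have h2 := hA x hx
    omega
  nonadj_le x hx := by
    have h1 := degIn_le_add_sdiff G x B B₀
    have h2 := hA x hx
    have h3 := degIn_add_card_nonadj G x (Y \ B)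
    have h4 := degIn_sdiff_add (G := G) (x := x) hBY
    have h5 := Finset.card_sdiff_add_card_eq_card hBY
    have h6 := hdY x (hAX hx)
    have h7 : h * n ≤ h * (degIn G x Y + B.card + 2 * t) := by
      rw [← hh] at *
      nlinarith
    have h8 := Nat.le_of_mul_le_mul_left h7 hh0
    omega
  nonadj_compl_le x hx := by
    have h1 := card_filter_le_add_sdiff (fun y => ¬ G.Adj x y) B B₀
    have h2 := hc x hx
    omega
  le_degIn_exc x hx := by
    have h1 := degIn_le_add_sdiff G x B₀ B
    have h2 := hEe x hx
    omega

/-- The extremal case for a coloring and coefficients adapted to `H`, with explicit parameters. -/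
lemma hasHFactor_of_sparse_pair [Fintype α] {V : Type*} [Fintype V] (H : SimpleGraph α)
    (g : α → Bool) (hg : Proper2Coloring H g)
    (w u h : ℕ) (hw : ∑ K, compColorCard H g true K = w) (hu : ∑ K, compColorCard H g false K = u)
    (hh : w + u = h) (hUW : ∀ K, compColorCard H g false K ≤ compColorCard H g true K)
    (zc zd : H.ConnectedComponent → ℤ)
    (hzc : ∑ K, zc K * ((compColorCard H g true K + compColorCard H g false K : ℕ) : ℤ) = 1)
    (hzd : ∑ K, zd K * ((compColorCard H g true K - compColorCard H g false K : ℕ) : ℤ) = 1)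
    (huw : u < w) (hu0 : 0 < u) (G : SimpleGraph V) (X Y : Finset V) (hG : BipartiteWith G X Y)
    (n e t : ℕ) (hX : X.card = n) (hY : Y.card = n) (hdvd : h ∣ Fintype.card V)
    (hdeg : ∀ v, u * n + h * (h ^ 2 + h) ≤ h * G.degree v)
    (A₀ B₀ : Finset V) (hA₀ : A₀ ⊆ X) (hB₀ : B₀ ⊆ Y) (hA₀c : A₀.card = w * n / h)
    (hB₀c : B₀.card = w * n / h) (hsparse : eAB G A₀ B₀ ≤ e * t)
    (hn : 100 * h ^ 2 * e ≤ n) (he : 10 * h ^ 2 * t ≤ e) (ht : h ^ 2 ≤ t) :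
    HasHFactor H G := by
  have hh0 : 0 < h := by omega
  have hdX : ∀ y ∈ Y, u * n + h * (h ^ 2 + h) ≤ h * degIn G y X := fun y hy => by
    rw [← hG.symm.degree_eq_degIn hy]
    exact hdeg y
  have hdY : ∀ x ∈ X, u * n + h * (h ^ 2 + h) ≤ h * degIn G x Y := fun x hx => by
    rw [← hG.degree_eq_degIn hx]
    exact hdeg x
  have hn1 : h * (w * n / h) ≤ w * n := Nat.mul_div_le _ _
  have hn2 : w * n < h * (w * n / h) + h := by
    have := Nat.lt_mul_div_succ (w * n) hh0
    linarith
  set n₀ := w * n / h with hn₀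
  have hsum : w * n + u * n = h * n := by rw [← add_mul, hh]
  have hhh : h ≤ h * (h ^ 2 + h) := Nat.le_mul_of_pos_right _ (by positivity)
  have ht0 : 0 < t := lt_of_lt_of_le (by positivity) ht
  have h3t : 3 * t ≤ e := by
    have : t ≤ h ^ 2 * t := Nat.le_mul_of_pos_left _ (by positivity)
    linarith
  have hcompl : ∀ d, u * n + h * (h ^ 2 + h) ≤ h * d → n - n₀ ≤ d := fun d hd => by
    have : h * n ≤ h * (d + n₀) := by linarith
    have := Nat.le_of_mul_le_mul_left this hh0
    omega
  have hen : 2 * e < n₀ := by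
    have h1 : n ≤ w * n := Nat.le_mul_of_pos_left _ (by omega)
    have h2 : h * e ≤ h ^ 2 * e := Nat.mul_le_mul_right _ (Nat.le_self_pow two_ne_zero h)
    have h3 : h ≤ h * e := Nat.le_mul_of_pos_right _ (by omega)
    have : h * (2 * e) < h * n₀ := by linarith
    exact Nat.lt_of_mul_lt_mul_left this
  obtain ⟨A, EX, hAX, hEXA, hA1, hA2, hEXt, hA, hEXe, hAc⟩ := exists_sparse_side G X A₀ B₀ hA₀ e t
    (fun y hy => by
      rw [Finset.card_sdiff_of_subset hA₀, hX, hA₀c]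
      exact hcompl _ (hdX y (hB₀ hy))) hsparse (by rwa [hB₀c])
  obtain ⟨B, EY, hBY, hEYB, hB1, hB2, hEYt, hB, hEYe, hBc⟩ := exists_sparse_side G Y B₀ A₀ hB₀ e t
    (fun y hy => by
      rw [Finset.card_sdiff_of_subset hB₀, hY, hB₀c]
      exact hcompl _ (hdY y (hA₀ hy)))
      (by rwa [eAB_eq_sum, sum_degIn_comm, ← eAB_eq_sum]) (by rwa [hA₀c])
  have hsize : ∀ S S₀ : Finset V, S₀.card = n₀ → (S \ S₀).card ≤ t → (S₀ \ S).card ≤ t →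
      h * S.card ≤ w * n + 2 * h * t ∧ w * n ≤ h * S.card + 2 * h * t := by
    intro S S₀ hS h1 h2
    have h3 := Finset.card_sdiff_add_card_inter S S₀
    have h4 := Finset.card_sdiff_add_card_inter S₀ S
    have h5 := Finset.inter_comm S S₀ ▸ Finset.card_le_card (Finset.inter_subset_right (s₁ := S₀) (s₂ := S))
    rw [Finset.inter_comm] at h4
    have h6 : h * S.card ≤ h * (n₀ + t) := Nat.mul_le_mul_left _ (by omega)
    have h7 : h * n₀ ≤ h * (S.card + t) := Nat.mul_le_mul_left _ (by omega)
    have h8 : h ≤ h * t := Nat.le_mul_of_pos_right _ ht0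
    constructor <;> linarith
  obtain ⟨ha1, ha2⟩ := hsize A A₀ hA₀c hA1 hA2
  obtain ⟨hb1, hb2⟩ := hsize B B₀ hB₀c hB1 hB2
  have hSA : SparseSide G X Y A B EX e t := sparseSide_of_core hh hh0 hY hdY hBY hAX hEXA hEXt hB1
    hB2 hA hEXe hAc hb2 h3t
  have hSB : SparseSide G Y X B A EY e t := sparseSide_of_core hh hh0 hX hdX hAX hBY hEYB hEYt hA1
    hA2 hB hEYe hBc ha2 h3t
  rcases le_total B.card A.card with hba | hab
  · exact hasHFactor_of_sparse_sides H g hg w u h hw hu hh hUW zc zd hzc hzd huw hu0 G X Y hG n e t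
      hX hY hdvd hdX A B EX EY hSA hSB ha1 ha2 hb1 hb2 hba hn he ht
  · exact hasHFactor_of_sparse_sides H g hg w u h hw hu hh hUW zc zd hzc hzd huw hu0 G Y X hG.symm
      n e t hY hX hdvd hdY B A EY EX hSB hSA hb1 hb2 ha1 ha2 hab hn he ht

/-- A spanning collection of copies exists trivially if `H` has no edges. -/
lemma hasHFactor_of_forall_not_adj [Fintype α] {V : Type*} [Fintype V] (H : SimpleGraph α)
    (G : SimpleGraph V) (hH : ∀ a b, ¬ H.Adj a b) (m : ℕ)
    (hV : Fintype.card V = m * Fintype.card α) : HasHFactor H G := by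
  have e : Fin m × α ≃ V := Fintype.equivOfCardEq (by simp [hV])
  exact hasHFactor_of_bijective H G e e.bijective fun j a b hab => absurd hab (hH a b)

/-- Theorem 4.9, the extremal case. Let `H` be a bipartite graph on `h`
vertices with `hcf(H) = 1`, `u = σ(H)`, `w = h - u`, `ζ = max |ζᵢ|` and `β = max |βᵢ|` for
valid coefficient systems as in Definition 1.7, and set
`c₁(H) = ζh² + β(w-u)² + (h/2 + 1)(w-u) + w`. Then there exist `a > 0` and `m₀` such that
every balanced bipartite graph `G[X,Y]` on `2n = mh` vertices with `m ≥ m₀`,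
`δ(G) ≥ (u/h)n + c₁(H)`, and sets `A ⊆ X`, `B ⊆ Y` with `|A| = |B| = ⌊wn/h⌋` and
`d(A,B) ≤ a`, contains an `H`-factor. -/
theorem statement_14 {α : Type*} [Fintype α] (H : SimpleGraph α) (h u w : ℕ)
    (hh : Fintype.card α = h) (c : α → Bool) (hc : Proper2Coloring H c)
    (hhcf : HcfOne H) (hu : u = sigmaBip H) (hw : w = h - u)
    (zc bc : H.ConnectedComponent → ℤ)
    (hz1 : (∑ K ∈ comps H, zc K * (compCard H K : ℤ)) = 1)
    (hz2 : ∀ K ∈ comps H, (zc K).natAbs ≤ (comps H).sup (compCard H))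
    (hb1 : (∑ K ∈ comps H, bc K * (compDiff H c K : ℤ)) = 1)
    (hb2 : ∀ K ∈ comps H, (bc K).natAbs ≤ (comps H).sup (compDiff H c))
    (Z B : ℕ) (hZ : Z = (comps H).sup fun K => (zc K).natAbs)
    (hB : B = (comps H).sup fun K => (bc K).natAbs)
    (c₁ : ℝ)
    (hc₁ : c₁ = (Z : ℝ) * (h : ℝ) ^ 2 + (B : ℝ) * ((w : ℝ) - (u : ℝ)) ^ 2 +
      ((h : ℝ) / 2 + 1) * ((w : ℝ) - (u : ℝ)) + (w : ℝ)) :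
    ∃ a : ℝ, 0 < a ∧ ∃ m₀ : ℕ,
      ∀ (V : Type) [Fintype V], ∀ (G : SimpleGraph V) (X Y : Finset V) (m n : ℕ),
        m₀ ≤ m → 2 * n = m * h → BipartiteWith G X Y → X.card = n → Y.card = n →
        (∀ v : V, ((u : ℝ) / h) * n + c₁ ≤ G.degree v) →
        ExtremalWith G X Y w h a →
        HasHFactor H G := by
  have hcardV : ∀ (V : Type) [Fintype V], ∀ (G : SimpleGraph V) (X Y : Finset V) (m n : ℕ),
      2 * n = m * h → BipartiteWith G X Y → X.card = n → Y.card = n → Fintype.card V = m * h := by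
    intro V _ G X Y m n hmn hG hX hY
    rw [← Finset.card_univ, ← hG.cover, Finset.card_union_of_disjoint hG.disj, hX, hY, ← hmn,
      two_mul]
  obtain ⟨g, hg, hgu, hUW⟩ := exists_minimal_coloring H c hc
  rw [← hu] at hgu
  have hgw : colorCard g true = w := by
    have := colorCard_add_colorCard g
    omega
  have hwu : w + u = h := by rw [← hgw, ← hgu, colorCard_add_colorCard, hh]
  rcases Nat.eq_zero_or_pos u with hu0 | hu0
  · have hgt : ∀ a, g a = true := by
      intro a
      rw [hu0, colorCard, Finset.card_eq_zero, Finset.filter_eq_empty_iff] at hgu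
      simpa using hgu (Finset.mem_univ a)
    refine ⟨1, one_pos, 0, fun V _ G X Y m n _ hmn hG hX hY _ _ => ?_⟩
    exact hasHFactor_of_forall_not_adj H G (fun a b hab => hg hab (by rw [hgt, hgt])) m
      (by rw [hcardV V G X Y m n hmn hG hX hY, hh])
  rw [colorCard_eq_sum H] at hgu hgw
  rw [comps_eq_univ] at hz1 hb1 hZ hB
  have hdiff : ∀ K, compDiff H c K = compColorCard H g true K - compColorCard H g false K := by
    intro K
    have h1 := hUW K
    rw [compDiff_eq_of_proper hc hg]
    change ((compColorCard H g true K : ℤ) - (compColorCard H g false K : ℤ)).natAbs = _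
    omega
  simp only [compCard_eq_add H g] at hz1
  simp only [hdiff] at hb1
  have hZ1 : 1 ≤ Z := by
    by_contra! hlt
    have h0 : ∀ K, zc K = 0 := fun K => by
      have := Finset.le_sup (f := fun K => (zc K).natAbs) (Finset.mem_univ K)
      rw [← hZ] at this
      omega
    simp [h0] at hz1
  have hB1 : 1 ≤ B := by
    by_contra! hlt
    have h0 : ∀ K, bc K = 0 := fun K => by
      have := Finset.le_sup (f := fun K => (bc K).natAbs) (Finset.mem_univ K)
      rw [← hB] at this
      omega
    simp [h0] at hb1
  have huw : u < w := by
    rw [← hgu, ← hgw]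
    by_contra! hle
    have h0 : ∀ K, compColorCard H g true K = compColorCard H g false K := fun K =>
      ((Finset.sum_eq_sum_iff_of_le fun K _ => hUW K).1
        (le_antisymm (Finset.sum_le_sum fun K _ => hUW K) hle) K (Finset.mem_univ K)).symm
    simp [h0] at hb1
  have hh1 : 1 ≤ h := by omega
  have hc₁' : (h : ℝ) ^ 2 + h ≤ c₁ := by
    have h1 : (1 : ℝ) ≤ Z := by exact_mod_cast hZ1
    have h2 : (1 : ℝ) ≤ B := by exact_mod_cast hB1
    have h3 : (1 : ℝ) ≤ (w : ℝ) - u := by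
      have : ((u + 1 : ℕ) : ℝ) ≤ w := by exact_mod_cast huw
      push_cast at this
      linarith
    have h4 : (w : ℝ) + u = h := by exact_mod_cast hwu
    have h5 : (h : ℝ) ^ 2 ≤ Z * (h : ℝ) ^ 2 := le_mul_of_one_le_left (sq_nonneg _) h1
    have h6 : 0 ≤ (B : ℝ) * ((w : ℝ) - (u : ℝ)) ^ 2 := by positivity
    have h7 : (h : ℝ) / 2 + 1 ≤ ((h : ℝ) / 2 + 1) * ((w : ℝ) - (u : ℝ)) :=
      le_mul_of_one_le_right (by positivity) h3
    rw [hc₁]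
    linarith
  have hhR : (0 : ℝ) < h := by exact_mod_cast hh1
  refine ⟨1 / (2000 * (h : ℝ) ^ 4) ^ 2, by positivity, 2000 * h ^ 6,
    fun V _ G X Y m n hm hmn hG hX hY hdeg hext => ?_⟩
  obtain ⟨A₀, hA₀, B₀, hB₀, hA₀c, hB₀c, hdens⟩ := hext
  rw [hX] at hA₀c hB₀c
  set t := n / (1000 * h ^ 4) with ht
  have hn : 1000 * h ^ 6 ≤ n := by
    have : m ≤ m * h := Nat.le_mul_of_pos_right _ hh1
    omega
  have ht1 : h ^ 2 ≤ t := by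
    rw [ht, Nat.le_div_iff_mul_le (by positivity)]
    calc h ^ 2 * (1000 * h ^ 4) = 1000 * h ^ 6 := by ring
      _ ≤ n := hn
  have ht2 : 1000 * h ^ 4 * t ≤ n := Nat.mul_div_le _ _
  have ht3 : n ≤ 2000 * h ^ 4 * t := by
    have h1 : n < 1000 * h ^ 4 * (t + 1) := Nat.lt_mul_div_succ _ (by positivity)
    have h2 : 1000 * h ^ 4 ≤ 1000 * h ^ 4 * t :=
      Nat.le_mul_of_pos_right _ (lt_of_lt_of_le (by positivity) ht1)
    linarith
  have hn₀ : 0 < w * n / h := by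
    refine Nat.div_pos ?_ hh1
    have h1 : h ≤ h ^ 6 := Nat.le_self_pow (by norm_num) h
    have h2 : n ≤ w * n := Nat.le_mul_of_pos_left _ (by omega)
    omega
  have hn₀n : w * n / h ≤ n := hA₀c ▸ hX ▸ Finset.card_le_card hA₀
  refine hasHFactor_of_sparse_pair H g hg w u h hgw hgu hwu hUW zc bc hz1 hb1 huw hu0 G X Y hG n
    (10 * h ^ 2 * t) t hX hY ⟨m, by rw [hcardV V G X Y m n hmn hG hX hY, mul_comm]⟩ (fun v => ?_)
    A₀ B₀ hA₀ hB₀ hA₀c hB₀c ?_ (le_trans (le_of_eq (by ring)) ht2) le_rfl ht1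
  · have h1 := hdeg v
    have h2 : (h : ℝ) * ((u : ℝ) / h * n + ((h : ℝ) ^ 2 + h)) ≤ h * G.degree v :=
      mul_le_mul_of_nonneg_left (by linarith) hhR.le
    have h3 : (h : ℝ) * ((u : ℝ) / h * n + ((h : ℝ) ^ 2 + h)) =
        u * n + h * ((h : ℝ) ^ 2 + h) := by
      field_simp
    rw [h3] at h2
    exact_mod_cast h2
  · unfold dens at hdens
    rw [hA₀c, hB₀c, div_le_iff₀ (by positivity), div_mul_eq_mul_div, one_mul,
      le_div_iff₀ (by positivity)] at hdens
    have h1 : eAB G A₀ B₀ * (2000 * h ^ 4) ^ 2 ≤ (w * n / h) * (w * n / h) := by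
      exact_mod_cast hdens
    have h2 : (w * n / h) * (w * n / h) ≤ (2000 * h ^ 4 * t) * (2000 * h ^ 4 * t) :=
      Nat.mul_le_mul (hn₀n.trans ht3) (hn₀n.trans ht3)
    have h3 : eAB G A₀ B₀ * (2000 * h ^ 4) ^ 2 ≤ t * t * (2000 * h ^ 4) ^ 2 :=
      (h1.trans h2).trans_eq (by ring)
    exact (Nat.le_of_mul_le_mul_right h3 (by positivity)).trans (Nat.mul_le_mul_right _
      (Nat.le_mul_of_pos_left _ (by positivity)))

end BipTiling
end

section
/- For every positive integer Δ there exists 0 < ρ < 1 such that the following holds: if a bipartite graph F with maximum degree Δ(F) ≤ Δ can be embedded into the complete bipartite graph K_{|X|,|Y|}, then F can be embedded into every bipartite graph G[X,Y] satisfying δ(X,Y) ≥ (1−ρ)|Y| and δ(Y,X) ≥ (1−ρ)|X|. -/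
open Finset

attribute [local instance] Classical.propDecidable

namespace BipTiling

variable {α β V : Type*}

/-- `f` maps every edge of `F` to a pair of vertices on different sides of `(P, Q)`. -/
def RespectsSides (F : SimpleGraph α) (P Q : Finset V) (f : α → V) : Prop :=
  ∀ ⦃a b : α⦄, F.Adj a b → (f a ∈ P ∧ f b ∈ Q) ∨ (f a ∈ Q ∧ f b ∈ P)

/-- The ordered edges of `F` that `f` does not map to edges of `G`. -/
noncomputable def badPairs [Fintype α] (F : SimpleGraph α) (G : SimpleGraph V) (f : α → V) :
    Finset (α × α) :=
  Finset.univ.filter fun p => F.Adj p.1 p.2 ∧ ¬ G.Adj (f p.1) (f p.2)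

lemma RespectsSides.symm {F : SimpleGraph α} {P Q : Finset V} {f : α → V}
    (h : RespectsSides F P Q f) : RespectsSides F Q P f :=
  fun _ _ hab => (h hab).symm

lemma card_filter_not_adj_le {G : SimpleGraph V} {x : V} {B : Finset V} {ρ : ℝ}
    (h : (1 - ρ) * (B.card : ℝ) ≤ (degIn G x B : ℝ)) :
    ((B.filter fun y => ¬ G.Adj x y).card : ℝ) ≤ ρ * B.card := by
  have hsum := Finset.card_filter_add_card_filter_not (s := B) (fun y => G.Adj x y)
  have hsum' : (degIn G x B : ℝ) + ((B.filter fun y => ¬ G.Adj x y).card : ℝ) = B.card := by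
    exact_mod_cast hsum
  linarith

lemma swap_mem_iff {P : Finset V} {x y : V} (h : x ∈ P ↔ y ∈ P) (v : V) :
    Equiv.swap x y v ∈ P ↔ v ∈ P := by
  rcases eq_or_ne v x with rfl | hx
  · simp [h]
  rcases eq_or_ne v y with rfl | hy
  · simp [h]
  rw [Equiv.swap_apply_of_ne_of_ne hx hy]

/-- There is a vertex of `P` with which the image of `a` can be exchanged without creating
new bad pairs. -/
lemma exists_exchange_vertex [Fintype α] {F : SimpleGraph α} {G : SimpleGraph V}
    {P Q : Finset V} {Δ : ℕ} {ρ : ℝ} (hΔρ : 2 * Δ * ρ < 1) (hρ : 0 ≤ ρ)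
    (hF : ∀ v, (Finset.univ.filter (F.Adj v)).card ≤ Δ)
    (hP : ∀ x ∈ P, (1 - ρ) * (Q.card : ℝ) ≤ (degIn G x Q : ℝ))
    (hQ : ∀ y ∈ Q, (1 - ρ) * (P.card : ℝ) ≤ (degIn G y P : ℝ))
    (hPQ : Q.card ≤ P.card) {f : α → V} (hinj : Function.Injective f) {a : α}
    (ha : f a ∈ P) (haQ : ∀ b, F.Adj a b → f b ∈ Q) :
    ∃ y ∈ P, (∀ b, F.Adj a b → G.Adj (f b) y) ∧
      ∀ c d, f c = y → F.Adj c d → f d ∈ Q → G.Adj (f a) (f d) := by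
  set B₁ : Finset V := (Finset.univ.filter (F.Adj a)).biUnion
    fun b => P.filter fun y => ¬ G.Adj (f b) y
  set U : Finset α := Finset.univ.filter fun d => f d ∈ Q ∧ ¬ G.Adj (f a) (f d) with hU
  set B₂ : Finset V := U.biUnion fun d => (Finset.univ.filter (F.Adj d)).image f
  have h₁ : (B₁.card : ℝ) ≤ Δ * (ρ * P.card) := by
    calc (B₁.card : ℝ)
        ≤ ∑ b ∈ Finset.univ.filter (F.Adj a), ((P.filter fun y => ¬ G.Adj (f b) y).card : ℝ) := by
          exact_mod_cast Finset.card_biUnion_le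
      _ ≤ ∑ _b ∈ Finset.univ.filter (F.Adj a), ρ * P.card := by
          refine Finset.sum_le_sum fun b hb => card_filter_not_adj_le (hQ _ (haQ b ?_))
          simpa using hb
      _ ≤ Δ * (ρ * P.card) := by
          rw [Finset.sum_const, nsmul_eq_mul]
          gcongr
          exact hF a
  have hUcard : (U.card : ℝ) ≤ ρ * Q.card := by
    refine le_trans ?_ (card_filter_not_adj_le (hP _ ha))
    rw [← Finset.card_image_of_injective U hinj]
    refine Nat.cast_le.mpr (Finset.card_le_card fun v hv => ?_)
    obtain ⟨d, hd, rfl⟩ := Finset.mem_image.mp hv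
    simpa [hU] using hd
  have h₂ : (B₂.card : ℝ) ≤ ρ * P.card * Δ := by
    have hle : B₂.card ≤ U.card * Δ :=
      Finset.card_biUnion_le_card_mul _ _ _ fun d _ => Finset.card_image_le.trans (hF d)
    calc (B₂.card : ℝ) ≤ U.card * Δ := by exact_mod_cast hle
      _ ≤ ρ * Q.card * Δ := by gcongr
      _ ≤ ρ * P.card * Δ := by gcongr
  have hPpos : (0 : ℝ) < P.card := by exact_mod_cast Finset.card_pos.mpr ⟨_, ha⟩
  have hlt : (B₁ ∪ B₂).card < P.card := by
    have hle : ((B₁ ∪ B₂).card : ℝ) ≤ B₁.card + B₂.card := by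
      exact_mod_cast Finset.card_union_le B₁ B₂
    have : ((B₁ ∪ B₂).card : ℝ) < P.card := by nlinarith
    exact_mod_cast this
  obtain ⟨y, hyP, hy⟩ := Finset.exists_mem_notMem_of_card_lt_card hlt
  simp only [Finset.mem_union, not_or] at hy
  refine ⟨y, hyP, fun b hb => ?_, fun c d hc hcd hd => ?_⟩
  · by_contra hn
    exact hy.1 (Finset.mem_biUnion.mpr ⟨b, by simpa using hb, by simp [hyP, hn]⟩)
  · by_contra hn
    exact hy.2 (Finset.mem_biUnion.mpr ⟨d, by simp [hU, hd, hn],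
      Finset.mem_image.mpr ⟨c, by simpa using hcd.symm, hc⟩⟩)

/-- A side-respecting injection with a bad pair can be improved by exchanging two images on the
larger side. -/
lemma exists_card_badPairs_lt [Fintype α] {F : SimpleGraph α} {G : SimpleGraph V}
    {P Q : Finset V} (hdisj : Disjoint P Q) {Δ : ℕ} {ρ : ℝ} (hΔρ : 2 * Δ * ρ < 1) (hρ : 0 ≤ ρ)
    (hF : ∀ v, (Finset.univ.filter (F.Adj v)).card ≤ Δ)
    (hP : ∀ x ∈ P, (1 - ρ) * (Q.card : ℝ) ≤ (degIn G x Q : ℝ))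
    (hQ : ∀ y ∈ Q, (1 - ρ) * (P.card : ℝ) ≤ (degIn G y P : ℝ))
    (hPQ : Q.card ≤ P.card) {f : α → V} (hinj : Function.Injective f)
    (hf : RespectsSides F P Q f) {a b : α} (hab : F.Adj a b) (hbad : ¬ G.Adj (f a) (f b)) :
    ∃ g : α → V, Function.Injective g ∧ RespectsSides F P Q g ∧
      (badPairs F G g).card < (badPairs F G f).card := by
  wlog ha : f a ∈ P generalizing a b
  · exact this hab.symm (fun h => hbad h.symm) ((hf hab).resolve_left fun h => ha h.1).2
  have hnot : ∀ {v}, v ∈ P → v ∉ Q := fun h h' => Finset.disjoint_left.mp hdisj h h'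
  have hside : ∀ {c d}, F.Adj c d → f c ∈ P → f d ∈ Q := fun hcd hc =>
    ((hf hcd).resolve_right fun h => hnot hc h.1).2
  obtain ⟨y, hyP, hy₁, hy₂⟩ :=
    exists_exchange_vertex hΔρ hρ hF hP hQ hPQ hinj ha fun b hb => hside hb ha
  set g : α → V := fun v => Equiv.swap (f a) y (f v) with hg
  have memP : ∀ v, g v ∈ P ↔ f v ∈ P := fun v => swap_mem_iff (by simp [ha, hyP]) _
  have memQ : ∀ v, g v ∈ Q ↔ f v ∈ Q := fun v => swap_mem_iff (by simp [hnot ha, hnot hyP]) _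
  have gQ : ∀ {v}, f v ∈ Q → g v = f v := fun {v} hv =>
    Equiv.swap_apply_of_ne_of_ne (fun h => hnot ha (h ▸ hv)) (fun h => hnot hyP (h ▸ hv))
  have keep : ∀ {c d}, F.Adj c d → f c ∈ P → G.Adj (f c) (f d) → G.Adj (g c) (g d) := by
    intro c d hcd hc hadj
    rw [gQ (hside hcd hc)]
    by_cases hca : f c = f a
    · obtain rfl := hinj hca
      simpa [hg] using (hy₁ d hcd).symm
    by_cases hcy : f c = y
    · simpa [hg, hcy] using hy₂ c d hcy hcd (hside hcd hc)
    · simpa [hg, Equiv.swap_apply_of_ne_of_ne hca hcy] using hadj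
  refine ⟨g, (Equiv.injective _).comp hinj, fun c d hcd => ?_, Finset.card_lt_card ?_⟩
  · simpa only [memP, memQ] using hf hcd
  refine (Finset.ssubset_iff_of_subset fun p hp => ?_).mpr ⟨(a, b), ?_, ?_⟩
  · simp only [badPairs, Finset.mem_filter, Finset.mem_univ, true_and] at hp ⊢
    refine ⟨hp.1, fun hadj => hp.2 ?_⟩
    rcases hf hp.1 with h | h
    · exact keep hp.1 h.1 hadj
    · exact (keep hp.1.symm h.2 hadj.symm).symm
  · simp [badPairs, hab, hbad]
  · have : G.Adj (g a) (g b) := by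
      rw [gQ (hside hab ha)]
      simpa [hg] using (hy₁ b hab).symm
    simp [badPairs, this]

lemma exists_isCopy_of_respectsSides [Fintype α] {F : SimpleGraph α} {G : SimpleGraph V}
    {P Q : Finset V} (hdisj : Disjoint P Q) {Δ : ℕ} {ρ : ℝ} (hΔρ : 2 * Δ * ρ < 1) (hρ : 0 ≤ ρ)
    (hF : ∀ v, (Finset.univ.filter (F.Adj v)).card ≤ Δ)
    (hP : ∀ x ∈ P, (1 - ρ) * (Q.card : ℝ) ≤ (degIn G x Q : ℝ))
    (hQ : ∀ y ∈ Q, (1 - ρ) * (P.card : ℝ) ≤ (degIn G y P : ℝ))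
    (hPQ : Q.card ≤ P.card) {f : α → V} (hinj : Function.Injective f)
    (hf : RespectsSides F P Q f) : ∃ g : α → V, IsCopy F G g := by
  induction hn : (badPairs F G f).card using Nat.strong_induction_on generalizing f with
  | _ n ih =>
    by_cases hcopy : IsCopy F G f
    · exact ⟨f, hcopy⟩
    have hbad : ∃ a b, F.Adj a b ∧ ¬ G.Adj (f a) (f b) := by
      by_contra! h
      exact hcopy ⟨hinj, h⟩
    obtain ⟨a, b, hab, hbad⟩ := hbad
    obtain ⟨g, hginj, hg, hlt⟩ :=
      exists_card_badPairs_lt hdisj hΔρ hρ hF hP hQ hPQ hinj hf hab hbad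
    exact ih _ (hn ▸ hlt) hginj hg rfl

/-- An embedding into a complete bipartite graph gives a side-respecting injection into any
vertex set containing disjoint sides of the same sizes. -/
lemma exists_respectsSides {F : SimpleGraph α} {X Y : Finset V} (hdisj : Disjoint X Y)
    {f : α → Fin X.card ⊕ Fin Y.card}
    (hf : IsCopy F (completeBipartiteGraph (Fin X.card) (Fin Y.card)) f) :
    ∃ g : α → V, Function.Injective g ∧ RespectsSides F X Y g := by
  let e : Fin X.card ⊕ Fin Y.card → V :=
    Sum.elim (fun i => (X.equivFin.symm i : V)) (fun i => (Y.equivFin.symm i : V))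
  have he : Function.Injective e := by
    refine Function.Injective.sumElim (Subtype.val_injective.comp (Equiv.injective _))
      (Subtype.val_injective.comp (Equiv.injective _)) fun i j h => ?_
    exact Finset.disjoint_left.mp hdisj (X.equivFin.symm i).2 (h ▸ (Y.equivFin.symm j).2)
  refine ⟨e ∘ f, he.comp hf.1, fun a b hab => ?_⟩
  have hadj := hf.2 hab
  rcases hfa : f a with i | i <;> rcases hfb : f b with j | j <;>
    simp [hfa, hfb, e] at hadj ⊢

/-- Lemma 4.10. For every positive integer `Δ` there exists `0 < ρ < 1`
such that if a bipartite graph `F` with `Δ(F) ≤ Δ` can be embedded into `K_{|X|,|Y|}`, then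
`F` can be embedded into every bipartite graph `G[X,Y]` with `δ(X,Y) ≥ (1-ρ)|Y|` and
`δ(Y,X) ≥ (1-ρ)|X|`. -/
theorem statement_15 (Δ : ℕ) (hΔ : 0 < Δ) :
    ∃ ρ : ℝ, 0 < ρ ∧ ρ < 1 ∧
      ∀ (W : Type) [Fintype W], ∀ F : SimpleGraph W, IsBip F → (∀ v : W, F.degree v ≤ Δ) →
      ∀ (V : Type) [Fintype V], ∀ (G : SimpleGraph V) (X Y : Finset V),
        BipartiteWith G X Y →
        (∃ f : W → Fin X.card ⊕ Fin Y.card,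
          IsCopy F (completeBipartiteGraph (Fin X.card) (Fin Y.card)) f) →
        (∀ x ∈ X, (1 - ρ) * (Y.card : ℝ) ≤ (degIn G x Y : ℝ)) →
        (∀ y ∈ Y, (1 - ρ) * (X.card : ℝ) ≤ (degIn G y X : ℝ)) →
        ∃ f : W → V, IsCopy F G f := by
  have hΔ' : (1 : ℝ) ≤ Δ := by exact_mod_cast hΔ
  have hρ : (0 : ℝ) < 1 / (3 * Δ) := by positivity
  refine ⟨1 / (3 * Δ), hρ, ?_, ?_⟩
  · rw [div_lt_one (by positivity)]
    linarith
  intro W _ F _ hdeg V _ G X Y hG ⟨f, hf⟩ hX hY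
  have hΔρ : 2 * (Δ : ℝ) * (1 / (3 * Δ)) < 1 := by
    field_simp
    norm_num
  have hF : ∀ v, (Finset.univ.filter (F.Adj v)).card ≤ Δ := fun v => by
    refine le_trans (le_of_eq ?_) (hdeg v)
    rw [← SimpleGraph.card_neighborFinset_eq_degree, SimpleGraph.neighborFinset_eq_filter]
  obtain ⟨g, hginj, hg⟩ := exists_respectsSides hG.disj hf
  rcases le_total Y.card X.card with h | h
  · exact exists_isCopy_of_respectsSides hG.disj hΔρ hρ.le hF hX hY h hginj hg
  · exact exists_isCopy_of_respectsSides hG.disj.symm hΔρ hρ.le hF hY hX h hginj hg.symm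

end BipTiling
end

section
/- Let u < w be positive integers and h = u + w. Let G[X,Y] be a complete bipartite graph with u/w ≤ |X|/|Y| ≤ 1, and let m = ⌊(|X|+|Y|)/h⌋. Then G has a K_{u,w}-tiling that leaves uncovered exactly l(X) vertices in X and l(Y) vertices in Y with l(X) + l(Y) ≤ h + (w−u) − 2, and in this tiling at least m/2 − h copies of K_{u,w} have their w-vertex sides in Y. -/
open Finset

attribute [local instance] Classical.propDecidable

namespace BipTiling

variable {α β V : Type*}

/-- Numbers `p`, `q` of copies of the two orientations giving a large `K_{u,w}`-tiling of
`K_{a,b}`. -/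
lemma exists_orientation_counts {u w a b : ℕ} (hu : 0 < u) (huw : u < w)
    (hab : u * b ≤ w * a) (hle : a ≤ b) :
    ∃ p q : ℕ, p * u + q * w ≤ a ∧ p * w + q * u ≤ b ∧
      a + b ≤ (p + q) * (u + w) + (u + w + (w - u) - 2) ∧ (a + b) / (u + w) ≤ 2 * p + 2 := by
  obtain ⟨d, rfl⟩ := Nat.exists_eq_add_of_lt huw
  set D := d + 1 with hD
  set h := u + (u + d + 1) with hh
  set m := (a + b) / h with hm
  have hdm : h * m + (a + b) % h = a + b := Nat.div_add_mod _ _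
  have hr : (a + b) % h < h := Nat.mod_lt _ (by omega)
  set r := (a + b) % h
  have hsub : u + d + 1 - u = D := by omega
  rw [hsub]
  have hmu : m * u ≤ a := by
    have h1 : h * (m * u) ≤ h * a := by nlinarith
    exact Nat.le_of_mul_le_mul_left h1 (by omega)
  -- The number of copies is `m`, or `m - 1` when the remainder is too small.
  obtain ⟨k, hkm, hmk, hlow, hup⟩ : ∃ k, k ≤ m ∧ m ≤ k + 1 ∧
      (k = 0 ∨ k * h + d ≤ a + b) ∧ a + b ≤ k * h + (h + D - 2) := by
    by_cases hrd : d ≤ r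
    · exact ⟨m, le_rfl, by omega, Or.inr (by nlinarith),
        by rw [mul_comm m h]; omega⟩
    · rcases hm0 : m with _ | n
      · exact ⟨0, le_rfl, by omega, Or.inl rfl, by rw [hm0] at hdm; omega⟩
      · rw [hm0] at hdm
        have h2 : h * (n + 1) = n * h + h := by ring
        exact ⟨n, by omega, by omega, Or.inr (by omega), by omega⟩
  have hku : k * u ≤ a := le_trans (Nat.mul_le_mul_right _ hkm) hmu
  have hkab : k * h ≤ a + b := by
    have := Nat.mul_le_mul_right h hkm
    rw [mul_comm m h] at this
    omega
  have hkw : k * (u + d + 1) = k * u + k * D := by rw [hD]; ring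
  have hkh : k * h = 2 * (k * u) + k * D := by rw [hh, hD]; ring
  -- `q` is the least number with `k * w ≤ b + q * D`.
  obtain ⟨q, hq1, hq2⟩ : ∃ q, k * u + k * D ≤ b + q * D ∧
      (q = 0 ∨ b + q * D ≤ k * u + k * D + d) := by
    have hex : ∃ q, k * u + k * D ≤ b + q * D := ⟨k, by omega⟩
    refine ⟨Nat.find hex, Nat.find_spec hex, ?_⟩
    rcases h0 : Nat.find hex with _ | n
    · exact Or.inl rfl
    · have := Nat.find_min hex (m := n) (by omega)
      have h3 : (n + 1) * D = n * D + D := by ring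
      exact Or.inr (by omega)
  have h2q : q = 0 ∨ 2 * q ≤ k + 1 := by
    rcases hq2 with h0 | h0
    · exact Or.inl h0
    · right
      have : 2 * (q * D) < (k + 2) * D := by
        have : (k + 2) * D = k * D + 2 * D := by ring
        omega
      have : 2 * q * D < (k + 2) * D := by rwa [mul_assoc]
      have := Nat.lt_of_mul_lt_mul_right this
      omega
  have hqk : q ≤ k := by
    rcases hk : k with _ | n
    · rcases hq2 with h0 | h0
      · omega
      · subst hk
        by_contra hc
        have : 1 ≤ q := by omega
        have := Nat.mul_le_mul_right D this
        simp only [zero_mul] at h0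
        omega
    · omega
  obtain ⟨p, rfl⟩ := Nat.exists_eq_add_of_le' hqk
  have e1 : (p + q) * D = p * D + q * D := by ring
  have e2 : p * u + q * (u + d + 1) = (p + q) * u + q * D := by rw [hD]; ring
  have e3 : p * (u + d + 1) + q * u = (p + q) * u + p * D := by rw [hD]; ring
  refine ⟨p, q, ?_, ?_, hup, by omega⟩
  · rw [e2]
    rcases hq2 with h0 | h0
    · simpa [h0] using hku
    · rcases hlow with h1 | h1
      · have : q = 0 := by omega
        simpa [this] using hku
      · omega
  · rw [e3]; omega

/-- `K_{a,b}` contains `p` copies of `K_{u,w}` with `w`-vertex side in the second part together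
with `q` copies of the opposite orientation, all vertex-disjoint, if the sizes allow it. -/
lemma exists_tiling_of_counts {u w a b p q : ℕ} (hu : 0 < u)
    (ha : p * u + q * w ≤ a) (hb : p * w + q * u ≤ b) :
    ∃ s : Finset (Fin u ⊕ Fin w → Fin a ⊕ Fin b),
      IsHTiling (completeBipartiteGraph (Fin u) (Fin w))
        (completeBipartiteGraph (Fin a) (Fin b)) s ∧
      (coveredSet s).card = (p + q) * (u + w) ∧
      p ≤ (s.filter fun f => ∀ j : Fin w, (f (Sum.inr j)).isRight = true).card := by
  obtain ⟨e⟩ : Nonempty ((Fin p × Fin u) ⊕ (Fin q × Fin w) ↪ Fin a) :=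
    Function.Embedding.nonempty_of_card_le (by simpa using ha)
  obtain ⟨g⟩ : Nonempty ((Fin p × Fin w) ⊕ (Fin q × Fin u) ↪ Fin b) :=
    Function.Embedding.nonempty_of_card_le (by simpa using hb)
  let F : Fin p ⊕ Fin q → Fin u ⊕ Fin w → Fin a ⊕ Fin b := fun i v =>
    match i, v with
    | .inl i, .inl x => .inl (e (.inl (i, x)))
    | .inl i, .inr y => .inr (g (.inl (i, y)))
    | .inr i, .inl x => .inr (g (.inr (i, x)))
    | .inr i, .inr y => .inl (e (.inr (i, y)))
  have hF : ∀ i j v v', F i v = F j v' → i = j ∧ v = v' := by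
    rintro (i | i) (j | j) (v | v) (v' | v') hv <;> simp_all [F]
  have hFinj : Function.Injective F := fun i j hij =>
    (hF i j (.inl ⟨0, hu⟩) (.inl ⟨0, hu⟩) (by rw [hij])).1
  refine ⟨Finset.univ.image F, ⟨?_, ?_⟩, ?_, ?_⟩
  · intro f hf
    obtain ⟨i, -, rfl⟩ := Finset.mem_image.1 hf
    refine ⟨fun v v' hv => (hF _ _ _ _ hv).2, ?_⟩
    rcases i with i | i <;> rintro (v | v) (v' | v') hv <;> simp_all [F]
  · intro f hf f' hf' hne v v' hv
    obtain ⟨i, -, rfl⟩ := Finset.mem_image.1 hf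
    obtain ⟨j, -, rfl⟩ := Finset.mem_image.1 hf'
    exact hne (by rw [(hF _ _ _ _ hv).1])
  · have hcov : coveredSet (Finset.univ.image F) =
        Finset.univ.image fun x : (Fin p ⊕ Fin q) × (Fin u ⊕ Fin w) => F x.1 x.2 := by
      ext y
      simp only [coveredSet, Finset.mem_biUnion, Finset.mem_image, Finset.mem_univ, true_and,
        Prod.exists, exists_exists_eq_and]
    rw [hcov, Finset.card_image_of_injective, Finset.card_univ]
    · simp
    · rintro ⟨i, v⟩ ⟨j, v'⟩ hv
      exact Prod.ext_iff.2 (hF _ _ _ _ hv)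
  · calc p = (Finset.univ.image fun i : Fin p => F (.inl i)).card := by
          have hinj : Function.Injective fun i : Fin p => F (.inl i) :=
            hFinj.comp Sum.inl_injective
          rw [Finset.card_image_of_injective _ hinj, Finset.card_univ, Fintype.card_fin]
      _ ≤ _ := by
          refine Finset.card_le_card fun f hf => ?_
          obtain ⟨i, -, rfl⟩ := Finset.mem_image.1 hf
          simp [F]

/-- Lemma 5.1, part 1. Let `u < w`, `h = u + w`, and let `K_{a,b}` be a
complete bipartite graph with `u/w ≤ a/b ≤ 1` and `m = ⌊(a+b)/h⌋`. Then `K_{a,b}` has a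
`K_{u,w}`-tiling leaving at most `h + (w-u) - 2` vertices uncovered, in which at least
`m/2 - h` copies of `K_{u,w}` have their `w`-vertex side in the second (larger) part. -/
theorem statement_16 (u w h : ℕ) (hu : 0 < u) (huw : u < w) (hh : h = u + w)
    (a b : ℕ) (hr1 : (u : ℝ) / (w : ℝ) ≤ (a : ℝ) / (b : ℝ)) (hr2 : a ≤ b)
    (m : ℕ) (hm : m = (a + b) / h) :
    ∃ s : Finset (Fin u ⊕ Fin w → Fin a ⊕ Fin b),
      IsHTiling (completeBipartiteGraph (Fin u) (Fin w))
        (completeBipartiteGraph (Fin a) (Fin b)) s ∧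
      (Finset.univ \ coveredSet s).card ≤ h + (w - u) - 2 ∧
      ((m : ℝ) / 2 - (h : ℝ)) ≤
        ((s.filter fun f => ∀ j : Fin w, (f (Sum.inr j)).isRight = true).card : ℝ) := by
  subst hh hm
  have hw : (0 : ℝ) < w := by exact_mod_cast hu.trans huw
  have ha : 0 < a := by
    rcases Nat.eq_zero_or_pos a with h0 | h0
    · have : (0 : ℝ) < (u : ℝ) / w := div_pos (by exact_mod_cast hu) hw
      simp only [h0, Nat.cast_zero, zero_div] at hr1
      exact absurd hr1 (not_le.2 this)
    · exact h0
  have hab : u * b ≤ w * a := by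
    rw [div_le_div_iff₀ hw (by exact_mod_cast ha.trans_le hr2), mul_comm (a : ℝ)] at hr1
    exact_mod_cast hr1
  obtain ⟨p, q, hpa, hpb, hcov, hp⟩ := exists_orientation_counts hu huw hab hr2
  obtain ⟨s, hs, hcard, hsp⟩ := exists_tiling_of_counts hu hpa hpb
  refine ⟨s, hs, ?_, ?_⟩
  · rw [Finset.card_sdiff_of_subset (Finset.subset_univ _), hcard]
    simp only [Finset.card_univ, Fintype.card_sum, Fintype.card_fin]
    omega
  · have h1 : (((a + b) / (u + w) : ℕ) : ℝ) ≤ 2 * p + 2 := by exact_mod_cast hp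
    have h2 : (p : ℝ) ≤ _ := Nat.cast_le.2 hsp
    have h3 : (1 : ℝ) ≤ ((u + w : ℕ) : ℝ) := by exact_mod_cast (by omega : 1 ≤ u + w)
    linarith

end BipTiling
end

section
/- Let u < w be positive integers, h = u + w, and let m > c be positive integers. Then the complete bipartite graph K_{mu−c, mw+c} contains a K_{u,w}-tiling that covers all but at most (c + u − 1)·h/u vertices. -/
open Finset

attribute [local instance] Classical.propDecidable

namespace BipTiling

variable {α β V : Type*}

/-- If `k * u ≤ a` and `k * w ≤ b`, then `K_{a,b}` contains a tiling by `k` copies of `K_{u,w}`,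
all of them with the part of size `u` inside the part of size `a`. -/
theorem exists_tiling_completeBipartiteGraph {u w a b k : ℕ} (ha : k * u ≤ a) (hb : k * w ≤ b) :
    ∃ s : Finset (Fin u ⊕ Fin w → Fin a ⊕ Fin b),
      IsHTiling (completeBipartiteGraph (Fin u) (Fin w))
        (completeBipartiteGraph (Fin a) (Fin b)) s ∧
      (Finset.univ \ coveredSet s).card + k * (u + w) = a + b := by
  let F : Fin k → Fin u ⊕ Fin w → Fin a ⊕ Fin b := fun j =>
    Sum.map (fun x => Fin.castLE ha (finProdFinEquiv (j, x)))
      (fun y => Fin.castLE hb (finProdFinEquiv (j, y)))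
  have hF : ∀ i j p q, F i p = F j q → i = j ∧ p = q := by
    rintro i j (p | p) (q | q) h
    · simpa only [F, Sum.map_inl, Sum.inl.injEq, Fin.castLE_inj, EmbeddingLike.apply_eq_iff_eq,
        Prod.mk.injEq] using h
    · simp [F] at h
    · simp [F] at h
    · simpa only [F, Sum.map_inr, Sum.inr.injEq, Fin.castLE_inj, EmbeddingLike.apply_eq_iff_eq,
        Prod.mk.injEq] using h
  refine ⟨Finset.univ.image F, ⟨fun f hf => ?_, fun f hf g hg hfg p q hpq => ?_⟩, ?_⟩
  · obtain ⟨j, -, rfl⟩ := Finset.mem_image.1 hf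
    refine ⟨fun p q h => (hF _ _ _ _ h).2, ?_⟩
    rintro (p | p) (q | q) h <;> simp_all [F]
  · obtain ⟨i, -, rfl⟩ := Finset.mem_image.1 hf
    obtain ⟨j, -, rfl⟩ := Finset.mem_image.1 hg
    exact hfg (congrArg F (hF _ _ _ _ hpq).1)
  · have hcov : coveredSet (Finset.univ.image F) =
        Finset.univ.image (fun p : Fin k × (Fin u ⊕ Fin w) => F p.1 p.2) := by
      ext v
      simp [coveredSet]
    have hinj : Function.Injective (fun p : Fin k × (Fin u ⊕ Fin w) => F p.1 p.2) :=
      fun p q h => Prod.ext (hF _ _ _ _ h).1 (hF _ _ _ _ h).2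
    have hcard : (coveredSet (Finset.univ.image F)).card = k * (u + w) := by
      rw [hcov, Finset.card_image_of_injective _ hinj]
      simp
    rw [← hcard, Finset.card_sdiff_add_card_eq_card (Finset.subset_univ _)]
    simp

/-- Lemma 5.1, part 2. Let `u < w` be positive integers, `h = u + w`, and
`m > c` positive integers. Then `K_{mu-c, mw+c}` contains a `K_{u,w}`-tiling that covers all
but at most `(c + u - 1)·h/u` vertices. -/
theorem statement_17 (u w h : ℕ) (hu : 0 < u) (huw : u < w) (hh : h = u + w)
    (m c : ℕ) (hc : 0 < c) (hcm : c < m) :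
    ∃ s : Finset (Fin u ⊕ Fin w → Fin (m * u - c) ⊕ Fin (m * w + c)),
      IsHTiling (completeBipartiteGraph (Fin u) (Fin w))
        (completeBipartiteGraph (Fin (m * u - c)) (Fin (m * w + c))) s ∧
      ((Finset.univ \ coveredSet s).card : ℝ) ≤ ((c : ℝ) + (u : ℝ) - 1) * (h : ℝ) / (u : ℝ) := by
  obtain ⟨q, hq⟩ : ∃ q, q = (c + u - 1) / u := ⟨_, rfl⟩
  have hqu : q * u ≤ c + u - 1 := hq ▸ Nat.div_mul_le_self _ _
  have hcq : c ≤ q * u := by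
    have h1 := Nat.lt_div_mul_add (a := c + u - 1) hu
    rw [← hq] at h1
    omega
  have hqm : q ≤ m := by
    by_contra! hlt
    have h1 : (m + 1) * u ≤ q * u := Nat.mul_le_mul_right u hlt
    have h2 : m * 1 ≤ m * u := Nat.mul_le_mul_left m hu
    rw [add_mul] at h1
    omega
  obtain ⟨k, rfl⟩ := Nat.exists_eq_add_of_le' hqm
  have hleft : k * u ≤ (k + q) * u - c := by
    rw [add_mul]
    omega
  have hright : k * w ≤ (k + q) * w + c := by
    rw [add_mul]
    omega
  obtain ⟨s, hs, hcard⟩ := exists_tiling_completeBipartiteGraph hleft hright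
  refine ⟨s, hs, ?_⟩
  have hrest : (Finset.univ \ coveredSet s).card = q * h := by
    have h1 : c ≤ (k + q) * u := by
      rw [add_mul]
      omega
    have h2 : (k + q) * u - c + ((k + q) * w + c) = q * h + k * (u + w) := by
      rw [hh, add_mul, add_mul, mul_add, mul_add]
      rw [add_mul] at h1
      omega
    omega
  have hqu' : (q : ℝ) * u ≤ c + u - 1 := by
    have h1 : q * u + 1 ≤ c + u := by omega
    have h2 : (q : ℝ) * u + 1 ≤ c + u := by exact_mod_cast h1
    linarith
  rw [hrest, le_div_iff₀ (by exact_mod_cast hu), Nat.cast_mul]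
  calc (q : ℝ) * h * u = q * u * h := by ring
    _ ≤ (c + u - 1) * h := by gcongr

end BipTiling
end
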